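/- arXiv:2108.00991 — 2 statements merged into one kernel-verified Lean document; each statement's English description precedes it below -/
import Mathlib

section
/- Let 0 < ε ≤ 10^{−20}, d = 20√ε, and λ = 13√ε. For every positive integer M and real c ≥ (1−ε)/M, there exist c' > 0 and n_0 (depending on ε, M, c) such that the following holds for all n ≥ n_0 for which k = ⌈2(n+1)/3⌉ is even. Let G be a graph on n vertices and suppose there are pairwise disjoint vertex subsets U_1,…,U_m,V_1,…,V_m with m ≥ (2/3+λ)M/2 and |U_i|, |V_i| ≥ cn for all i, such that each pair (U_i,V_i) is ε-regular in G with d(U_i,V_i) ≥ d−ε, and the union of all the sets U_i and V_i is (200M,6)-well-connected in G. Then G contains at least (c'k)^k copies of the cycle C_k. -/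
open Finset

/-- A path copy as a sequence: `k` distinct vertices with consecutive vertices adjacent. -/
def IsPathSeq {V : Type*} (G : SimpleGraph V) (k : ℕ) (f : Fin k → V) : Prop :=
  Function.Injective f ∧ ∀ (i : Fin k) (h : i.val + 1 < k), G.Adj (f i) (f ⟨i.val + 1, h⟩)

/-- Number of copies of the path `P_k` in `G` (sequences identified with their reversals). -/
noncomputable def pathCount {V : Type*} (G : SimpleGraph V) (k : ℕ) : ℕ :=
  Nat.card {f : Fin k → V // IsPathSeq G k f} / 2

/-- A cycle copy as a cyclic sequence: `k` distinct vertices, cyclically consecutive adjacent. -/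
def IsCycleSeq {V : Type*} (G : SimpleGraph V) (k : ℕ) (f : Fin k → V) : Prop :=
  Function.Injective f ∧ ∀ i : Fin k, G.Adj (f i) (f ⟨(i.val + 1) % k, Nat.mod_lt _ i.pos⟩)

/-- Number of copies of the cycle `C_k` in `G` (identified up to rotation and reflection). -/
noncomputable def cycleCount {V : Type*} (G : SimpleGraph V) (k : ℕ) : ℕ :=
  Nat.card {f : Fin k → V // IsCycleSeq G k f} / (2 * k)

/-- The red graph of the coloring `χ(a,b)`: complete bipartite between the first `a`
vertices and the remaining `b` vertices. The blue graph is its complement. -/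
def chiRed (a b : ℕ) : SimpleGraph (Fin (a + b)) :=
  SimpleGraph.fromRel (fun x y => (x.val < a) ≠ (y.val < a))

/-- Number of neighbors of `x` inside the set `Y`. -/
noncomputable def nbrCount {V : Type*} (G : SimpleGraph V) (x : V) (Y : Finset V) : ℕ :=
  Nat.card {y : V // y ∈ Y ∧ G.Adj x y}

/-- `e(X,Y)`: number of pairs in `X × Y` that are edges. -/
noncomputable def eCnt {V : Type*} (G : SimpleGraph V) (X Y : Finset V) : ℕ :=
  Nat.card {p : V × V // p.1 ∈ X ∧ p.2 ∈ Y ∧ G.Adj p.1 p.2}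

/-- Edge density `d(X,Y) = e(X,Y)/(|X||Y|)`. -/
noncomputable def dens {V : Type*} (G : SimpleGraph V) (X Y : Finset V) : ℝ :=
  (eCnt G X Y : ℝ) / ((X.card : ℝ) * (Y.card : ℝ))

/-- `(X,Y)` is an `ε`-regular pair in `G`. -/
def IsRegularPair {V : Type*} (G : SimpleGraph V) (X Y : Finset V) (ε : ℝ) : Prop :=
  ∀ U, U ⊆ X → ∀ W, W ⊆ Y → ε * X.card ≤ (U.card : ℝ) → ε * Y.card ≤ (W.card : ℝ) →
    |dens G U W - dens G X Y| ≤ ε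

/-- `W` is `(t,l)`-well-connected in `G`: any two distinct vertices of `W` are joined by
at least `t` internally vertex-disjoint paths of length at most `l`. -/
def WellConnected {V : Type*} (G : SimpleGraph V) (W : Set V) (t l : ℕ) : Prop :=
  ∀ u ∈ W, ∀ v ∈ W, u ≠ v →
    ∃ P : Fin t → G.Walk u v, Function.Injective P ∧
      (∀ i, (P i).IsPath ∧ (P i).length ≤ l) ∧
      (∀ i j, i ≠ j → ∀ x, x ∈ (P i).support → x ∈ (P j).support → x = u ∨ x = v)

/-- Extremal coloring with parameter `α` (the red graph is `R`, blue is `Rᶜ`). -/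
def IsExtremalColoring {V : Type*} [Fintype V] [DecidableEq V] (R : SimpleGraph V) (α : ℝ) : Prop :=
  ∃ A : Finset V,
    (2/3 - α) * (Fintype.card V : ℝ) ≤ (A.card : ℝ) ∧
    (1/3 - α) * (Fintype.card V : ℝ) ≤ ((Aᶜ).card : ℝ) ∧
    ((1 - α ≤ dens R A A ∧ 1 - α ≤ dens Rᶜ A Aᶜ) ∨
     (1 - α ≤ dens Rᶜ A A ∧ 1 - α ≤ dens R A Aᶜ))

/-- A path of length `l` in `G[A,B]`: `l+1` distinct vertices alternating between the
parts `A` and `B`, with consecutive vertices adjacent in `G`. -/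
def IsAltPath {Ω : Type*} (G : SimpleGraph Ω) (A B : Finset Ω) (l : ℕ) (f : Fin (l + 1) → Ω) : Prop :=
  Function.Injective f ∧
  (∀ i : Fin (l + 1), f i ∈ A ∨ f i ∈ B) ∧
  (∀ (i : Fin (l + 1)) (h : i.val + 1 < l + 1),
    G.Adj (f i) (f ⟨i.val + 1, h⟩) ∧
    ((f i ∈ A ∧ f ⟨i.val + 1, h⟩ ∈ B) ∨ (f i ∈ B ∧ f ⟨i.val + 1, h⟩ ∈ A)))

/-- A path with `k` vertices alternating between `V` and `U`, starting in `V`. -/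
def IsBipPathFromV {Ω : Type*} (G : SimpleGraph Ω) (U V : Finset Ω) (k : ℕ) (f : Fin k → Ω) : Prop :=
  Function.Injective f ∧
  (∀ i : Fin k, (i.val % 2 = 0 → f i ∈ V) ∧ (i.val % 2 = 1 → f i ∈ U)) ∧
  (∀ (i : Fin k) (h : i.val + 1 < k), G.Adj (f i) (f ⟨i.val + 1, h⟩))


open Classical in
/-- Abstract regular pair. -/
structure GP {α : Type*} (G : SimpleGraph α) (U V : Finset α) (eU eV sU sV : ℕ) : Prop where
  disj : Disjoint U V
  p1 : ∀ B, B ⊆ V → sV ≤ #B → #{u ∈ U | #{v ∈ B | G.Adj u v} < 3 * eV} < eU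
  p1' : ∀ A, A ⊆ U → sU ≤ #A → #{v ∈ V | #{u ∈ A | G.Adj v u} < 3 * eU} < eV
  p2 : ∀ A, A ⊆ U → ∀ B, B ⊆ V → eU ≤ #A → eV ≤ #B → ∃ a ∈ A, ∃ b ∈ B, G.Adj a b
  hU : sU + 2 * eU ≤ #U
  hV : sV + 2 * eV ≤ #V

lemma cons_family {α : Type*} [DecidableEq α] (A : Finset α) (a N : ℕ) (hA : a ≤ #A)
    (Q : α → List α → Prop)
    (h : ∀ x ∈ A, ∃ L : Finset (List α), N ≤ #L ∧ ∀ l ∈ L, Q x l) :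
    ∃ L : Finset (List α), a * N ≤ #L ∧ ∀ l ∈ L, ∃ x ∈ A, ∃ l', l = x :: l' ∧ Q x l' := by
  choose! L h1 h2 using h
  refine ⟨(A.sigma L).image (fun p => p.1 :: p.2), ?_, ?_⟩
  · rw [Finset.card_image_of_injective, Finset.card_sigma]
    · calc a * N ≤ #A * N := Nat.mul_le_mul_right _ hA
        _ = ∑ x ∈ A, N := by simp
        _ ≤ _ := Finset.sum_le_sum h1
    · rintro ⟨x, l⟩ ⟨y, l'⟩ h
      simp at h
      simp [h]
  · intro l hl
    simp only [Finset.mem_image, Finset.mem_sigma] at hl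
    obtain ⟨⟨x, l'⟩, ⟨hx, hl'⟩, rfl⟩ := hl
    exact ⟨x, hx, l', rfl, h2 x hx l' hl'⟩

open Classical in
lemma long_paths {α : Type*} (G : SimpleGraph α) (U V : Finset α)
    (eU eV sU sV : ℕ) (h : GP G U V eU eV sU sV) (a : ℕ) (haU : a ≤ eU) (haV : a ≤ eV)
    (y : α) (R : Finset α) (hRU : R ⊆ U) (hR : eU ≤ #R) (hRy : ∀ r ∈ R, G.Adj r y) (t : ℕ) :
    ∀ (u : α) (U' V' : Finset α), U' ⊆ U → V' ⊆ V → Disjoint U' R →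
      2 * eV ≤ #{v ∈ V' | G.Adj u v} → sU + t ≤ #U' → sV + t ≤ #V' →
      ∃ L : Finset (List α), a ^ (2 * t) ≤ #L ∧ ∀ l ∈ L, l.length = 2 * t + 2 ∧ l.Nodup ∧
        (∀ z ∈ l, z ∈ U' ∨ z ∈ V' ∨ z ∈ R) ∧ (u :: l ++ [y]).IsChain G.Adj := by
  have hd := Finset.disjoint_left.1 h.disj
  induction t with
  | zero =>
    intro u U' V' hU' hV' hUR hu h1 h2
    obtain ⟨r, hr, v, hv, hrv⟩ := h.p2 R hRU {v ∈ V' | G.Adj u v}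
      ((Finset.filter_subset _ _).trans hV') hR (by omega)
    simp only [Finset.mem_filter] at hv
    refine ⟨{[v, r]}, by simp, ?_⟩
    simp only [Finset.mem_singleton, forall_eq]
    refine ⟨rfl, ?_, ?_, ?_⟩
    · simp; exact hrv.ne'
    · simp [hv.1, hr]
    · simp [hv.2, hrv.symm, hRy r hr]
  | succ t ih =>
    intro u U' V' hU' hV' hUR hu h1 h2
    have hUR' := Finset.disjoint_left.1 hUR
    set A := {v ∈ V' | G.Adj u v} \ {v ∈ V | #{u ∈ U' | G.Adj v u} < 3 * eU} with hA
    have hAc : a ≤ #A := by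
      have := Finset.le_card_sdiff {v ∈ V | #{u ∈ U' | G.Adj v u} < 3 * eU} {v ∈ V' | G.Adj u v}
      have := h.p1' U' hU' (by omega)
      rw [hA]; omega
    have key := cons_family A a (a * a ^ (2 * t)) hAc
      (fun v l => l.length = 2 * t + 3 ∧ l.Nodup ∧
        (∀ z ∈ l, z ∈ U' ∨ z ∈ V'.erase v ∨ z ∈ R) ∧ (v :: l ++ [y]).IsChain G.Adj) ?_
    · obtain ⟨L, hL, hL2⟩ := key
      refine ⟨L, le_trans (le_of_eq (by ring)) hL, ?_⟩
      intro l hl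
      obtain ⟨v, hv, l', rfl, q1, q2, q3, q4⟩ := hL2 l hl
      have hvV : v ∈ V' ∧ G.Adj u v := by
        simp only [hA, Finset.mem_sdiff, Finset.mem_filter] at hv; exact hv.1
      refine ⟨by simp [q1]; omega, ?_, ?_, ?_⟩
      · rw [List.nodup_cons]
        refine ⟨fun hvl => ?_, q2⟩
        rcases q3 v hvl with h | h | h
        · exact hd (hU' h) (hV' hvV.1)
        · simp at h
        · exact hd (hRU h) (hV' hvV.1)
      · intro z hz
        rcases List.mem_cons.1 hz with rfl | hz
        · exact Or.inr (Or.inl hvV.1)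
        · rcases q3 z hz with h | h | h
          · exact Or.inl h
          · exact Or.inr (Or.inl (Finset.mem_of_mem_erase h))
          · exact Or.inr (Or.inr h)
      · simp only [List.cons_append] at q4 ⊢
        exact List.isChain_cons_cons.2 ⟨hvV.2, q4⟩
    · intro v hv
      simp only [hA, Finset.mem_sdiff, Finset.mem_filter, not_and, not_lt] at hv
      obtain ⟨⟨hvV, huv⟩, hv3⟩ := hv
      have hv3 := hv3 (hV' hvV)
      have hce : #(V'.erase v) = #V' - 1 := Finset.card_erase_of_mem hvV
      set B := {w ∈ U' | G.Adj v w} \ {w ∈ U | #{x ∈ V'.erase v | G.Adj w x} < 3 * eV} with hB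
      have hBc : a ≤ #B := by
        have := Finset.le_card_sdiff {w ∈ U | #{x ∈ V'.erase v | G.Adj w x} < 3 * eV} {w ∈ U' | G.Adj v w}
        have := h.p1 (V'.erase v) ((Finset.erase_subset _ _).trans hV') (by omega)
        rw [hB]; omega
      obtain ⟨L, hL, hL2⟩ := cons_family B a (a ^ (2 * t)) hBc
        (fun w l => l.length = 2 * t + 2 ∧ l.Nodup ∧
          (∀ z ∈ l, z ∈ U'.erase w ∨ z ∈ V'.erase v ∨ z ∈ R) ∧ (w :: l ++ [y]).IsChain G.Adj) (by
        intro w hw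
        simp only [hB, Finset.mem_sdiff, Finset.mem_filter, not_and, not_lt] at hw
        obtain ⟨⟨hwU, hvw⟩, hw3⟩ := hw
        have hw3 := hw3 (hU' hwU)
        have hce' : #(U'.erase w) = #U' - 1 := Finset.card_erase_of_mem hwU
        exact ih w (U'.erase w) (V'.erase v) ((Finset.erase_subset _ _).trans hU')
          ((Finset.erase_subset _ _).trans hV') (hUR.mono_left (Finset.erase_subset _ _))
          (by omega) (by omega) (by omega))
      refine ⟨L, hL, ?_⟩
      intro l hl
      obtain ⟨w, hw, l', rfl, q1, q2, q3, q4⟩ := hL2 l hl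
      have hwU : w ∈ U' ∧ G.Adj v w := by
        simp only [hB, Finset.mem_sdiff, Finset.mem_filter] at hw; exact hw.1
      refine ⟨by simp [q1], ?_, ?_, ?_⟩
      · rw [List.nodup_cons]
        refine ⟨fun hvl => ?_, q2⟩
        rcases q3 w hvl with h | h | h
        · simp at h
        · exact hd (hU' hwU.1) (hV' (Finset.mem_of_mem_erase h))
        · exact hUR' hwU.1 h
      · intro z hz
        rcases List.mem_cons.1 hz with rfl | hz
        · exact Or.inl hwU.1
        · rcases q3 z hz with h | h | h
          · exact Or.inl (Finset.mem_of_mem_erase h)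
          · exact Or.inr (Or.inl h)
          · exact Or.inr (Or.inr h)
      · simp only [List.cons_append] at q4 ⊢
        exact List.isChain_cons_cons.2 ⟨hwU.2, q4⟩

open Classical in
/-- Long paths between two good vertices avoiding `F`. -/
lemma long_paths' {α : Type*} (G : SimpleGraph α) (U V : Finset α)
    (eU eV sU sV : ℕ) (h : GP G U V eU eV sU sV) (a : ℕ) (haU : a ≤ eU) (haV : a ≤ eV)
    (x y : α) (hx : 3 * eV ≤ #{v ∈ V | G.Adj x v}) (hy : 3 * eU ≤ #{u ∈ U | G.Adj y u})
    (F : Finset α) (hFU : #F < eU) (hFV : #F < eV) (t : ℕ)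
    (htU : t + sU + 2 * eU ≤ #U) (htV : t + sV + 2 * eV ≤ #V) :
    ∃ L : Finset (List α), a ^ (2 * t) ≤ #L ∧ ∀ l ∈ L, l.length = 2 * t + 2 ∧ l.Nodup ∧
        (∀ z ∈ l, (z ∈ U ∨ z ∈ V) ∧ z ∉ F) ∧ (x :: l ++ [y]).IsChain G.Adj := by
  have h1 := Finset.le_card_sdiff F {u ∈ U | G.Adj y u}
  obtain ⟨R, hR1, hR2⟩ := Finset.exists_subset_card_eq (s := {u ∈ U | G.Adj y u} \ F) (n := eU) (by omega)
  have hRs : ∀ r ∈ R, r ∈ U ∧ G.Adj y r ∧ r ∉ F := by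
    intro r hr
    have := hR1 hr
    simp only [Finset.mem_sdiff, Finset.mem_filter] at this
    tauto
  have e1 := Finset.le_card_sdiff F U
  have e2 := Finset.le_card_sdiff R (U \ F)
  have e3 := Finset.le_card_sdiff F V
  have e4 : 2 * eV ≤ #{v ∈ V \ F | G.Adj x v} := by
    have := Finset.le_card_sdiff F {v ∈ V | G.Adj x v}
    have e : {v ∈ V | G.Adj x v} \ F = {v ∈ V \ F | G.Adj x v} := by
      ext z; simp; tauto
    rw [e] at this
    omega
  obtain ⟨L, hL, hL2⟩ := long_paths G U V eU eV sU sV h a haU haV y R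
    (fun r hr => (hRs r hr).1) hR2.ge (fun r hr => (hRs r hr).2.1.symm) t x
    ((U \ F) \ R) (V \ F) (Finset.sdiff_subset.trans Finset.sdiff_subset) Finset.sdiff_subset
    Finset.sdiff_disjoint e4 (by omega) (by omega)
  refine ⟨L, hL, fun l hl => ?_⟩
  obtain ⟨q1, q2, q3, q4⟩ := hL2 l hl
  refine ⟨q1, q2, fun z hz => ?_, q4⟩
  rcases q3 z hz with h | h | h
  · simp only [Finset.mem_sdiff] at h; tauto
  · simp only [Finset.mem_sdiff] at h; tauto
  · have := hRs z h
    tauto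

open Classical in
/-- Linking two good vertices of `U`. -/
lemma link {α : Type*} (G : SimpleGraph α) (U V : Finset α)
    (eU eV sU sV : ℕ) (h : GP G U V eU eV sU sV)
    (p q : α) (hp : 3 * eV ≤ #{v ∈ V | G.Adj p v}) (hq : 3 * eV ≤ #{v ∈ V | G.Adj q v})
    (F : Finset α) (hFU : #F < eU) (hFV : #F < eV) :
    ∃ v u w, G.Adj p v ∧ G.Adj v u ∧ G.Adj u w ∧ G.Adj w q ∧ v ∉ F ∧ u ∉ F ∧ w ∉ F ∧ v ≠ w ∧
      u ∈ U ∧ w ∈ V ∧ 3 * eV ≤ #{v ∈ V | G.Adj u v} ∧ 3 * eU ≤ #{u ∈ U | G.Adj w u} := by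
  have b1 := h.p1' U subset_rfl (by have := h.hU; omega)
  have b2 := h.p1 V subset_rfl (by have := h.hV; omega)
  have c1 := Finset.le_card_sdiff F {v ∈ V | G.Adj q v}
  have c2 := Finset.le_card_sdiff {v ∈ V | #{u ∈ U | G.Adj v u} < 3 * eU} ({v ∈ V | G.Adj q v} \ F)
  obtain ⟨w, hw⟩ : (({v ∈ V | G.Adj q v} \ F) \ {v ∈ V | #{u ∈ U | G.Adj v u} < 3 * eU}).Nonempty := by
    rw [← Finset.card_pos]; omega
  simp only [Finset.mem_sdiff, Finset.mem_filter, not_and, not_lt] at hw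
  obtain ⟨⟨⟨hwV, hqw⟩, hwF⟩, hw3⟩ := hw
  have hw3 := hw3 hwV
  have d1 := Finset.le_card_sdiff F {u ∈ U | G.Adj w u}
  have d2 := Finset.le_card_sdiff {u ∈ U | #{v ∈ V | G.Adj u v} < 3 * eV} ({u ∈ U | G.Adj w u} \ F)
  have f1 := Finset.le_card_sdiff F {v ∈ V | G.Adj p v}
  have f2 := Finset.pred_card_le_card_erase (a := w) (s := {v ∈ V | G.Adj p v} \ F)
  obtain ⟨u, hu, v, hv, huv⟩ := h.p2 (({u ∈ U | G.Adj w u} \ F) \ {u ∈ U | #{v ∈ V | G.Adj u v} < 3 * eV})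
    (by intro z hz; simp at hz; tauto) (({v ∈ V | G.Adj p v} \ F).erase w)
    (by intro z hz; simp at hz; tauto) (by omega) (by omega)
  simp only [Finset.mem_sdiff, Finset.mem_filter, not_and, not_lt, Finset.mem_erase] at hu hv
  exact ⟨v, u, w, hv.2.1.2, huv.symm, hu.1.1.2.symm, hqw.symm, hv.2.2, hu.1.2, hwF, hv.1, hu.1.1.1,
    hwV, hu.2 hu.1.1.1, hw3⟩

lemma conn0 {α : Type*} (G : SimpleGraph α) (W : Set α) (t : ℕ) (h : WellConnected G W t 6)
    (u v : α) (hu : u ∈ W) (hv : v ∈ W) (huv : u ≠ v) (F : Finset α) (huF : u ∉ F) (hvF : v ∉ F)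
    (hF : #F < t) :
    ∃ mid : List α, mid.length ≤ 5 ∧ (u :: mid ++ [v]).Nodup ∧ (u :: mid ++ [v]).IsChain G.Adj ∧
      ∀ x ∈ mid, x ∉ F := by
  obtain ⟨P, -, hP, hd⟩ := h u hu v hv huv
  have : ∃ i, ∀ x ∈ (P i).support, x ∉ F := by
    by_contra! hcon
    choose f hf1 hf2 using hcon
    have hinj : Function.Injective f := by
      intro i j hij
      by_contra hne
      rcases hd i j hne (f i) (hf1 i) (hij ▸ hf1 j) with h | h
      · exact huF (h ▸ hf2 i)
      · exact hvF (h ▸ hf2 i)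
    have := Finset.card_le_card_of_injOn (s := (Finset.univ : Finset (Fin t))) (t := F) f
      (fun i _ => hf2 i) hinj.injOn
    simp at this
    omega
  obtain ⟨i, hi⟩ := this
  obtain ⟨hp, hl⟩ := hP i
  generalize P i = p at hi hp hl
  cases p with
  | nil => exact absurd rfl huv
  | cons hadj q =>
    have hs : q.support = q.support.dropLast ++ [v] := by
      conv_lhs => rw [← List.dropLast_append_getLast q.support_ne_nil]
      rw [SimpleGraph.Walk.getLast_support]
    have hs2 : u :: q.support.dropLast ++ [v] = (SimpleGraph.Walk.cons hadj q).support := by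
      rw [SimpleGraph.Walk.support_cons, List.cons_append, ← hs]
    refine ⟨q.support.dropLast, ?_, ?_, ?_, ?_⟩
    · simp at hl ⊢; omega
    · rw [hs2]; exact hp.support_nodup
    · rw [hs2]; exact SimpleGraph.Walk.isChain_adj_support _
    · intro x hx
      apply hi
      rw [← hs2]; exact List.mem_append_left _ (List.mem_cons_of_mem _ hx)

lemma conn1 {α : Type*} [DecidableEq α] (G : SimpleGraph α) (W : Set α) (t : ℕ) (h : WellConnected G W t 6)
    (A B : Finset α) (hA : ∀ a ∈ A, a ∈ W) (hB : ∀ a ∈ B, a ∈ W) (hAB : Disjoint A B)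
    (F : Finset α) (hFA : #F < #A) (hFB : #F < #B) (hF : #F < t) :
    ∃ a ∈ A, ∃ b ∈ B, ∃ mid : List α, mid.length ≤ 5 ∧ (a :: mid ++ [b]).Nodup ∧
      (a :: mid ++ [b]).IsChain G.Adj ∧ ∀ x ∈ a :: mid ++ [b], x ∉ F := by
  obtain ⟨a, ha, haF⟩ := Finset.exists_mem_notMem_of_card_lt_card hFA
  obtain ⟨b, hb, hbF⟩ := Finset.exists_mem_notMem_of_card_lt_card hFB
  have hab : a ≠ b := fun e => Finset.disjoint_left.1 hAB ha (e ▸ hb)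
  obtain ⟨mid, h1, h2, h3, h4⟩ := conn0 G W t h a b (hA a ha) (hB b hb) hab F haF hbF hF
  refine ⟨a, ha, b, hb, mid, h1, h2, h3, ?_⟩
  intro x hx
  simp at hx
  rcases hx with rfl | hx | rfl
  · exact haF
  · exact h4 x hx
  · exact hbF

lemma conn2 {α : Type*} [DecidableEq α] (G : SimpleGraph α) (W : Set α) (t : ℕ) (h : WellConnected G W t 6)
    (A B : Finset α) (hA : ∀ a ∈ A, a ∈ W) (hB : ∀ a ∈ B, a ∈ W) (hAB : Disjoint A B)
    (F : Finset α) (hFA : #F + 14 < #A) (hFB : #F + 14 < #B) (hF : #F + 14 < t) :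
    ∃ a ∈ A, ∃ b ∈ B, ∃ mid : List α, ∃ a' ∈ A, ∃ b' ∈ B, ∃ mid' : List α,
      mid.length ≤ 5 ∧ mid'.length ≤ 5 ∧ Even (mid.length + mid'.length) ∧
      ((a :: mid ++ [b]) ++ (a' :: mid' ++ [b'])).Nodup ∧
      (a :: mid ++ [b]).IsChain G.Adj ∧ (a' :: mid' ++ [b']).IsChain G.Adj ∧
      ∀ x ∈ (a :: mid ++ [b]) ++ (a' :: mid' ++ [b']), x ∉ F := by
  obtain ⟨a1, ha1, b1, hb1, m1, l1, n1, c1, d1⟩ := conn1 G W t h A B hA hB hAB F (by omega) (by omega) (by omega)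
  have e1 := List.toFinset_card_le (a1 :: m1 ++ [b1])
  have e1' := Finset.card_union_le F (a1 :: m1 ++ [b1]).toFinset
  simp only [List.length_append, List.length_cons, List.length_nil] at e1
  obtain ⟨a2, ha2, b2, hb2, m2, l2, n2, c2, d2⟩ := conn1 G W t h A B hA hB hAB
    (F ∪ (a1 :: m1 ++ [b1]).toFinset) (by omega) (by omega) (by omega)
  have e2 := List.toFinset_card_le (a2 :: m2 ++ [b2])
  have e2' := Finset.card_union_le (F ∪ (a1 :: m1 ++ [b1]).toFinset) (a2 :: m2 ++ [b2]).toFinset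
  simp only [List.length_append, List.length_cons, List.length_nil] at e2
  obtain ⟨a3, ha3, b3, hb3, m3, l3, n3, c3, d3⟩ := conn1 G W t h A B hA hB hAB
    (F ∪ (a1 :: m1 ++ [b1]).toFinset ∪ (a2 :: m2 ++ [b2]).toFinset) (by omega) (by omega) (by omega)
  simp only [Finset.mem_union, List.mem_toFinset, not_or] at d2 d3
  have key : Even (m1.length + m2.length) ∨ Even (m1.length + m3.length) ∨ Even (m2.length + m3.length) := by
    simp only [Nat.even_iff]; omega
  rcases key with k | k | k
  · refine ⟨a1, ha1, b1, hb1, m1, a2, ha2, b2, hb2, m2, l1, l2, k, ?_, c1, c2, ?_⟩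
    · exact n1.append n2 (fun x hx hx' => (d2 x hx').2 hx)
    · intro x hx
      rcases List.mem_append.1 hx with hx | hx
      · exact d1 x hx
      · exact (d2 x hx).1
  · refine ⟨a1, ha1, b1, hb1, m1, a3, ha3, b3, hb3, m3, l1, l3, k, ?_, c1, c3, ?_⟩
    · exact n1.append n3 (fun x hx hx' => (d3 x hx').1.2 hx)
    · intro x hx
      rcases List.mem_append.1 hx with hx | hx
      · exact d1 x hx
      · exact (d3 x hx).1.1
  · refine ⟨a2, ha2, b2, hb2, m2, a3, ha3, b3, hb3, m3, l2, l3, k, ?_, c2, c3, ?_⟩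
    · exact n2.append n3 (fun x hx hx' => (d3 x hx').2 hx)
    · intro x hx
      rcases List.mem_append.1 hx with hx | hx
      · exact (d2 x hx).1
      · exact (d3 x hx).1.1

open Classical in
def GoodU {α : Type*} (G : SimpleGraph α) (V : Finset α) (eV : ℕ) (u : α) : Prop :=
  3 * eV ≤ #{v ∈ V | G.Adj u v}

open Classical in
lemma goodU_card {α : Type*} (G : SimpleGraph α) (U V : Finset α)
    (eU eV sU sV : ℕ) (h : GP G U V eU eV sU sV) : eU ≤ #{u ∈ U | GoodU G V eV u} := by
  have b2 := h.p1 V subset_rfl (by have := h.hV; omega)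
  have := h.hU
  have e := Finset.card_filter_add_card_filter_not (s := U) (fun u => GoodU G V eV u)
  have : {u ∈ U | ¬ GoodU G V eV u} = {u ∈ U | #{v ∈ V | G.Adj u v} < 3 * eV} := by
    ext u; simp [GoodU]
  rw [this] at e
  omega

lemma chain_cat {α : Type*} {R : α → α → Prop} {x y z : α} {l l' : List α}
    (h : (x :: l ++ [y]).IsChain R) (h' : (y :: l' ++ [z]).IsChain R) :
    (x :: (l ++ y :: l') ++ [z]).IsChain R := by
  have : x :: (l ++ y :: l') ++ [z] = (x :: l) ++ y :: (l' ++ [z]) := by simp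
  rw [this, List.isChain_split]
  exact ⟨h, h'⟩

lemma chain_rev {α : Type*} (G : SimpleGraph α) {x y : α} {l : List α}
    (h : (x :: l ++ [y]).IsChain G.Adj) : (y :: l.reverse ++ [x]).IsChain G.Adj := by
  have : y :: l.reverse ++ [x] = (x :: l ++ [y]).reverse := by simp
  rw [this, List.isChain_reverse]
  exact h.imp (fun _ _ h => h.symm)

/-- Skeleton path statement. -/
lemma skeleton {α : Type*} [DecidableEq α] (G : SimpleGraph α) (W : Set α) (t m : ℕ)
    (hW : WellConnected G W t 6) (hm : 0 < m) (Us Vs : Fin m → Finset α)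
    (eU eV sU sV : Fin m → ℕ) (hG : ∀ i, GP G (Us i) (Vs i) (eU i) (eV i) (sU i) (sV i))
    (hUd : ∀ i j, i ≠ j → Disjoint (Us i) (Us j)) (hUW : ∀ i, ∀ x ∈ Us i, x ∈ W)
    (hK : ∀ i, 20 * m + 60 < eU i ∧ 20 * m + 60 < eV i) (hKt : 20 * m + 60 < t) (j : ℕ) (hj : j < m) :
    ∃ (x z : α) (T : List α), x ∈ Us ⟨0, hm⟩ ∧ z ∈ Us ⟨0, hm⟩ ∧
      GoodU G (Vs ⟨0, hm⟩) (eV ⟨0, hm⟩) x ∧ GoodU G (Vs ⟨0, hm⟩) (eV ⟨0, hm⟩) z ∧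
      (x :: T ++ [z]).Nodup ∧ (x :: T ++ [z]).IsChain G.Adj ∧ Odd T.length ∧ T.length ≤ 20 * j + 3 ∧
      ∀ i : Fin m, i.val ≤ j → ∃ p q, p ∈ Us i ∧ q ∈ Vs i ∧ GoodU G (Vs i) (eV i) p ∧
        GoodU G (Us i) (eU i) q ∧ [p, q] <:+: T := by
  classical
  set i0 : Fin m := ⟨0, hm⟩ with hi0
  induction j with
  | zero =>
    have hc := goodU_card G _ _ _ _ _ _ (hG i0)
    have hk := hK i0
    obtain ⟨x, hx, z, hz, hxz⟩ := Finset.one_lt_card.1 (show 1 < #{u ∈ Us i0 | GoodU G (Vs i0) (eV i0) u} by omega)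
    simp only [Finset.mem_filter] at hx hz
    have hcard : #({x, z} : Finset α) ≤ 2 := Finset.card_le_two
    obtain ⟨v, u, w, h1, h2, h3, h4, h5, h6, h7, h8, h9, h10, h11, h12⟩ :=
      link G _ _ _ _ _ _ (hG i0) x z hx.2 hz.2 {x, z} (by omega) (by omega)
    refine ⟨x, z, [v, u, w], hx.1, hz.1, hx.2, hz.2, ?_, ?_, ⟨1, rfl⟩, by simp, ?_⟩
    · have := h2.ne
      have := h3.ne
      simp at h5 h6 h7 ⊢
      grind
    · simp [*]
    · intro i hi
      have : i = i0 := by ext; simp [hi0]; omega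
      subst this
      exact ⟨u, w, h9, h10, h11, h12, [v], [], by simp⟩
  | succ j ih =>
    obtain ⟨x, z, T, hx, hz, gx, gz, nd, ch, odd, len, inf⟩ := ih (by omega)
    set i1 : Fin m := ⟨j + 1, hj⟩ with hi1
    have hc0 := goodU_card G _ _ _ _ _ _ (hG i0)
    have hc1 := goodU_card G _ _ _ _ _ _ (hG i1)
    have hk0 := hK i0
    have hk1 := hK i1
    have hne : i0 ≠ i1 := by simp [hi0, hi1]
    set F := (x :: T ++ [z]).toFinset with hF
    have cF : #F ≤ 20 * j + 5 := by
      have := List.toFinset_card_le (x :: T ++ [z])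
      simp only [List.length_append, List.length_cons, List.length_nil] at this
      rw [hF]; omega
    obtain ⟨a, ha, b, hb, mid, a', ha', b', hb', mid', l1, l2, ev, nd2, c1, c2, av⟩ :=
      conn2 G W t hW {u ∈ Us i0 | GoodU G (Vs i0) (eV i0) u} {u ∈ Us i1 | GoodU G (Vs i1) (eV i1) u}
        (fun a ha => hUW i0 a (Finset.mem_filter.1 ha).1)
        (fun a ha => hUW i1 a (Finset.mem_filter.1 ha).1)
        ((hUd _ _ hne).mono (Finset.filter_subset _ _) (Finset.filter_subset _ _))
        F (by omega) (by omega) (by omega)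
    simp only [Finset.mem_filter] at ha hb ha' hb'
    set Q := (a :: mid ++ [b]) ++ (a' :: mid' ++ [b']) with hQ
    have cF2 : #(F ∪ Q.toFinset) ≤ 20 * j + 19 := by
      have h1 := Finset.card_union_le F Q.toFinset
      have h2 := List.toFinset_card_le Q
      simp only [hQ, List.length_append, List.length_cons, List.length_nil] at h2
      rw [← hQ] at h2
      omega
    obtain ⟨v, u, w, h1, h2, h3, h4, h5, h6, h7, h8, h9, h10, h11, h12⟩ :=
      link G _ _ _ _ _ _ (hG i0) z a gz ha.2 (F ∪ Q.toFinset) (by omega) (by omega)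
    have cF3 : #(F ∪ Q.toFinset ∪ [v, u, w].toFinset) ≤ 20 * j + 22 := by
      have h1 := Finset.card_union_le (F ∪ Q.toFinset) [v, u, w].toFinset
      have h2 := List.toFinset_card_le [v, u, w]
      simp only [List.length_cons, List.length_nil] at h2
      omega
    obtain ⟨v', u', w', g1, g2, g3, g4, g5, g6, g7, g8, g9, g10, g11, g12⟩ :=
      link G _ _ _ _ _ _ (hG i1) b b' hb.2 hb'.2 (F ∪ Q.toFinset ∪ [v, u, w].toFinset) (by omega) (by omega)
    have k1 : (z :: [v, u, w] ++ [a]).IsChain G.Adj := by simp [*]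
    have k2 : (b :: [v', u', w'] ++ [b']).IsChain G.Adj := by simp [*]
    have k3 := chain_rev G c2
    have hch := chain_cat (chain_cat (chain_cat (chain_cat ch k1) c1) k2) k3
    set T' := (((T ++ z :: [v, u, w]) ++ a :: mid) ++ b :: [v', u', w']) ++ b' :: mid'.reverse with hT'
    refine ⟨x, a', T', hx, ha'.1, gx, ha'.2, ?_, hch, ?_, ?_, ?_⟩
    · have hperm : (x :: T' ++ [a']).Perm (((x :: T ++ [z]) ++ Q) ++ [v, u, w] ++ [v', u', w']) := by
        rw [List.perm_iff_count]
        intro y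
        simp only [hT', hQ, List.count_append, List.count_cons, List.count_nil, List.count_reverse]
        omega
      rw [hperm.nodup_iff]
      have e2 := h2.ne
      have e3 := h3.ne
      have f2 := g2.ne
      have f3 := g3.ne
      simp only [Finset.mem_union, hF, List.mem_toFinset, not_or] at h5 h6 h7 g5 g6 g7 av
      refine ((nd.append nd2 ?_).append ?_ ?_).append ?_ ?_
      · intro y hy hy'
        exact av y hy' hy
      · simp; grind
      · intro y hy hy'
        rw [List.mem_append] at hy
        simp only [List.mem_cons, List.not_mem_nil, or_false] at hy'
        grind
      · simp; grind
      · intro y hy hy'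
        rw [List.mem_append, List.mem_append] at hy
        simp only [List.mem_cons, List.not_mem_nil, or_false] at hy'
        grind
    · rw [Nat.odd_iff] at odd ⊢
      rw [Nat.even_iff] at ev
      simp [hT']
      omega
    · simp [hT']; omega
    · intro i hi
      rcases Nat.lt_or_ge j i.val with hlt | hge
      · have : i = i1 := by ext; simp [hi1]; omega
        subst this
        refine ⟨u', w', g9, g10, g11, g12, ((T ++ z :: [v, u, w]) ++ a :: mid) ++ [b, v'], b' :: mid'.reverse, ?_⟩
        simp [hT']
      · obtain ⟨p, q, r1, r2, r3, r4, r5⟩ := inf i hge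
        refine ⟨p, q, r1, r2, r3, r4, r5.trans ?_⟩
        refine ⟨[], z :: [v, u, w] ++ a :: mid ++ b :: [v', u', w'] ++ b' :: mid'.reverse, ?_⟩
        simp [hT']

/-- Skeleton cycle. -/
lemma skeleton_cycle {α : Type*} [DecidableEq α] (G : SimpleGraph α) (W : Set α) (t m : ℕ)
    (hW : WellConnected G W t 6) (hm : 0 < m) (Us Vs : Fin m → Finset α)
    (eU eV sU sV : Fin m → ℕ) (hG : ∀ i, GP G (Us i) (Vs i) (eU i) (eV i) (sU i) (sV i))
    (hUd : ∀ i j, i ≠ j → Disjoint (Us i) (Us j)) (hUW : ∀ i, ∀ x ∈ Us i, x ∈ W)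
    (hK : ∀ i, 20 * m + 60 < eU i ∧ 20 * m + 60 < eV i) (hKt : 20 * m + 60 < t) :
    ∃ (x z : α) (T : List α),
      (x :: T ++ [z]).Nodup ∧ (x :: T ++ [z]).IsChain G.Adj ∧ G.Adj z x ∧ Even (T.length) ∧
      T.length ≤ 20 * m + 10 ∧
      ∀ i : Fin m, ∃ p q, p ∈ Us i ∧ q ∈ Vs i ∧ GoodU G (Vs i) (eV i) p ∧
        GoodU G (Us i) (eU i) q ∧ [p, q] <:+: (x :: T ++ [z]) := by
  obtain ⟨x, z, T, hx, hz, gx, gz, nd, ch, odd, len, inf⟩ :=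
    skeleton G W t m hW hm Us Vs eU eV sU sV hG hUd hUW hK hKt (m - 1) (by omega)
  have hk := hK ⟨0, hm⟩
  have cF : #(x :: T ++ [z]).toFinset ≤ 20 * m + 5 := by
    have := List.toFinset_card_le (x :: T ++ [z])
    simp only [List.length_append, List.length_cons, List.length_nil] at this
    omega
  obtain ⟨v, u, w, h1, h2, h3, h4, h5, h6, h7, h8, h9, h10, h11, h12⟩ :=
      link G _ _ _ _ _ _ (hG ⟨0, hm⟩) z x gz gx (x :: T ++ [z]).toFinset (by omega) (by omega)
  refine ⟨x, w, T ++ z :: [v, u], ?_, ?_, h4, ?_, ?_, ?_⟩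
  · have e : x :: (T ++ z :: [v, u]) ++ [w] = (x :: T ++ [z]) ++ [v, u, w] := by simp
    rw [e]
    simp only [List.mem_toFinset] at h5 h6 h7
    have e2 := h2.ne
    have e3 := h3.ne
    refine nd.append ?_ ?_
    · simp; grind
    · intro y hy hy'
      simp only [List.mem_cons, List.not_mem_nil, or_false] at hy'
      grind
  · exact chain_cat ch (by simp [*])
  · rw [Nat.odd_iff] at odd
    rw [Nat.even_iff]
    simp; omega
  · simp; omega
  · intro i
    obtain ⟨p, q, r1, r2, r3, r4, r5⟩ := inf i (by omega)
    refine ⟨p, q, r1, r2, r3, r4, r5.trans ?_⟩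
    exact ⟨[x], z :: [v, u] ++ [w], by simp⟩

lemma infix_insert {α : Type*} {p q x y : α} {l1 l2 I : List α} (hpx : p ≠ x)
    (h : [p, q] <:+: l1 ++ x :: y :: l2) : [p, q] <:+: l1 ++ x :: I ++ y :: l2 := by
  obtain ⟨s, t, h⟩ := h
  have h' : s ++ ([p, q] ++ t) = (l1 ++ [x]) ++ (y :: l2) := by
    rw [← List.append_assoc, h]; simp
  rcases List.append_eq_append_iff.1 h' with ⟨r, hr1, hr2⟩ | ⟨r, hr1, hr2⟩
  · -- l1 ++ [x] = s ++ r
    match r, hr1, hr2 with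
    | [], hr1, hr2 =>
      refine ⟨l1 ++ x :: I, t, ?_⟩
      simp at hr2
      simp [hr2]
    | [r0], hr1, hr2 =>
      exfalso
      have := List.append_inj_right' hr1 rfl
      simp at hr2 this
      exact hpx (hr2.1.trans this.symm)
    | r0 :: r1 :: r', hr1, hr2 =>
      simp at hr2
      obtain ⟨rfl, rfl, hr2⟩ := hr2
      refine ⟨s, r' ++ I ++ y :: l2, ?_⟩
      have : l1 ++ x :: I ++ y :: l2 = (l1 ++ [x]) ++ (I ++ y :: l2) := by simp
      rw [this, hr1]
      simp
  · refine ⟨l1 ++ x :: I ++ r, t, ?_⟩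
    rw [hr2]; simp

lemma replace_all {α : Type*} [DecidableEq α] (G : SimpleGraph α) (m : ℕ)
    (Us Vs : Fin m → Finset α)
    (eU eV sU sV : Fin m → ℕ) (hG : ∀ i, GP G (Us i) (Vs i) (eU i) (eV i) (sU i) (sV i))
    (hUd : ∀ i j, i ≠ j → Disjoint (Us i) (Us j)) (hVd : ∀ i j, i ≠ j → Disjoint (Vs i) (Vs j))
    (hUVd : ∀ i j, Disjoint (Us i) (Vs j))
    (a : ℕ) (ha : ∀ i, a ≤ eU i ∧ a ≤ eV i)
    (C : List α) (x z : α) (hC : C.Nodup) (hch : C.IsChain G.Adj) (hx : C.head? = some x)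
    (hz : C.getLast? = some z)
    (hCe : ∀ i, C.length < eU i ∧ C.length < eV i)
    (p q : Fin m → α) (hp : ∀ i, p i ∈ Us i)
    (hpg : ∀ i, GoodU G (Vs i) (eV i) (p i)) (hqg : ∀ i, GoodU G (Us i) (eU i) (q i))
    (hinf : ∀ i, [p i, q i] <:+: C)
    (t : ℕ → ℕ) (ht : ∀ i : Fin m, t i + sU i + 2 * eU i ≤ #(Us i) ∧ t i + sV i + 2 * eV i ≤ #(Vs i))
    (j : ℕ) (hj : j ≤ m) :
    ∃ L : Finset (List α), a ^ (2 * ∑ i ∈ range j, t i) ≤ #L ∧ ∀ l ∈ L,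
      l.Nodup ∧ l.IsChain G.Adj ∧ l.head? = some x ∧ l.getLast? = some z ∧
      l.length = C.length + 2 * j + 2 * ∑ i ∈ range j, t i ∧
      (∀ y ∈ l, y ∈ C ∨ ∃ i : Fin m, i.val < j ∧ y ∈ Us i ∪ Vs i) ∧
      ∀ i : Fin m, j ≤ i.val → [p i, q i] <:+: l := by
  classical
  induction j with
  | zero =>
    refine ⟨{C}, by simp, ?_⟩
    simp only [Finset.mem_singleton, forall_eq]
    refine ⟨hC, hch, hx, hz, by simp, fun y hy => Or.inl hy, fun i _ => hinf i⟩
  | succ j ih =>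
    obtain ⟨L, hL, hL2⟩ := ih (by omega)
    set i1 : Fin m := ⟨j, hj⟩ with hi1
    have cF : #C.toFinset ≤ C.length := List.toFinset_card_le C
    have hce := hCe i1
    obtain ⟨N, hN, hN2⟩ := long_paths' G _ _ _ _ _ _ (hG i1) a (ha i1).1 (ha i1).2 (p i1) (q i1)
      (hpg i1) (hqg i1) C.toFinset (by omega) (by omega) (t j) (ht i1).1 (ht i1).2
    have hsplit : ∀ l ∈ L, ∃ l1 l2, l = l1 ++ p i1 :: q i1 :: l2 := by
      intro l hl
      obtain ⟨s, u, h⟩ := (hL2 l hl).2.2.2.2.2.2 i1 (le_of_eq rfl)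
      exact ⟨s, u, by rw [← h]; simp⟩
    choose! f1 f2 hf using hsplit
    set S := (Us i1 ∪ Vs i1) \ C.toFinset with hS
    have hlS : ∀ l ∈ L, ∀ y ∈ l, y ∉ S := by
      intro l hl y hy hyS
      simp only [hS, Finset.mem_sdiff, Finset.mem_union, List.mem_toFinset] at hyS
      rcases (hL2 l hl).2.2.2.2.2.1 y hy with h | ⟨i, hi, h⟩
      · exact hyS.2 h
      · have hne : i ≠ i1 := by
          intro e; rw [e] at hi; simp [hi1] at hi
        rw [Finset.mem_union] at h
        rcases h with h | h <;> rcases hyS.1 with h' | h'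
        · exact Finset.disjoint_left.1 (hUd _ _ hne) h h'
        · exact Finset.disjoint_left.1 (hUVd _ _) h h'
        · exact Finset.disjoint_left.1 (hUVd _ _) h' h
        · exact Finset.disjoint_left.1 (hVd _ _ hne) h h'
    have hfil : ∀ l ∈ L, ∀ I ∈ N,
        (f1 l ++ p i1 :: I ++ q i1 :: f2 l).filter (fun y => decide (y ∈ S)) = I ∧
        (f1 l ++ p i1 :: I ++ q i1 :: f2 l).filter (fun y => decide (y ∉ S)) = l := by
      intro l hl I hI
      have h1 : ∀ y ∈ f1 l, y ∉ S := fun y hy => hlS l hl y (by rw [hf l hl]; simp [hy])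
      have h2 : ∀ y ∈ f2 l, y ∉ S := fun y hy => hlS l hl y (by rw [hf l hl]; simp [hy])
      have h3 : p i1 ∉ S := hlS l hl _ (by rw [hf l hl]; simp)
      have h4 : q i1 ∉ S := hlS l hl _ (by rw [hf l hl]; simp)
      have h5 : ∀ y ∈ I, y ∈ S := fun y hy => by simpa [hS] using (hN2 I hI).2.2.1 y hy
      constructor
      · have e1 : (f1 l).filter (fun y => decide (y ∈ S)) = [] := by
          rw [List.filter_eq_nil_iff]; simpa using h1
        have e2 : (f2 l).filter (fun y => decide (y ∈ S)) = [] := by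
          rw [List.filter_eq_nil_iff]; simpa using h2
        have e3 : I.filter (fun y => decide (y ∈ S)) = I := by
          rw [List.filter_eq_self]; simpa using h5
        simp only [List.filter_append, List.filter_cons, e1, e2, e3]
        simp [h3, h4]
      · have e1 : (f1 l).filter (fun y => decide (y ∉ S)) = f1 l := by
          rw [List.filter_eq_self]; simpa using h1
        have e2 : (f2 l).filter (fun y => decide (y ∉ S)) = f2 l := by
          rw [List.filter_eq_self]; simpa using h2
        have e3 : I.filter (fun y => decide (y ∉ S)) = [] := by
          rw [List.filter_eq_nil_iff]; simpa using h5
        simp only [List.filter_append, List.filter_cons, e1, e2, e3]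
        conv_rhs => rw [hf l hl]
        simp [h3, h4]
    refine ⟨(L ×ˢ N).image (fun w => f1 w.1 ++ p i1 :: w.2 ++ q i1 :: f2 w.1), ?_, ?_⟩
    · rw [Finset.card_image_of_injOn, Finset.card_product, Finset.sum_range_succ, mul_add, pow_add]
      · exact Nat.mul_le_mul hL hN
      · rintro ⟨l, I⟩ hw ⟨l', I'⟩ hw' heq
        simp only [Finset.coe_product, Set.mem_prod, Finset.mem_coe] at hw hw'
        simp only at heq
        have A := hfil l hw.1 I hw.2
        have B := hfil l' hw'.1 I' hw'.2
        rw [heq] at A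
        exact Prod.ext (A.2.symm.trans B.2) (A.1.symm.trans B.1)
    · intro l' hl'
      simp only [Finset.mem_image, Finset.mem_product] at hl'
      obtain ⟨⟨l, I⟩, ⟨hl, hI⟩, rfl⟩ := hl'
      simp only
      obtain ⟨r1, r2, r3, r4, r5, r6, r7⟩ := hL2 l hl
      obtain ⟨s1, s2, s3, s4⟩ := hN2 I hI
      have hlf := hf l hl
      have hSl := hlS l hl
      generalize f1 l = A at *
      generalize f2 l = B at *
      subst hlf
      refine ⟨?_, ?_, ?_, ?_, ?_, ?_, ?_⟩
      · have hperm : (A ++ p i1 :: I ++ q i1 :: B).Perm ((A ++ p i1 :: q i1 :: B) ++ I) := by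
          rw [List.perm_iff_count]
          intro y
          simp only [List.count_append, List.count_cons]
          omega
        rw [hperm.nodup_iff]
        exact r1.append s2 (fun y hy hy' => hSl y hy (by simpa [hS] using s3 y hy'))
      · rw [List.isChain_split] at r2
        have e : A ++ p i1 :: I ++ q i1 :: B = A ++ p i1 :: (I ++ q i1 :: B) := by simp
        rw [e, List.isChain_split]
        refine ⟨r2.1, ?_⟩
        rw [← List.cons_append, List.isChain_split]
        exact ⟨s4, (List.isChain_cons_cons.1 r2.2).2⟩
      · cases A with
        | nil => simpa using r3
        | cons b A => simpa using r3
      · rw [← r4]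
        simp [List.getLast?_append, List.getLast?_cons]
      · rw [Finset.sum_range_succ]
        simp only [List.length_append, List.length_cons] at r5 ⊢
        omega
      · intro y hy
        have hy2 : y ∈ (A ++ p i1 :: q i1 :: B) ∨ y ∈ I := by
          simp only [List.mem_append, List.mem_cons] at hy ⊢; tauto
        rcases hy2 with h | h
        · rcases r6 y h with h | ⟨i, hi, h⟩
          · exact Or.inl h
          · exact Or.inr ⟨i, by omega, h⟩
        · exact Or.inr ⟨i1, by simp [hi1], Finset.mem_union.2 (s3 y h).1⟩
      · intro i hi
        refine infix_insert ?_ (r7 i (by omega))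
        intro e
        have hne : i ≠ i1 := by
          intro e; rw [e] at hi; simp [hi1] at hi
        exact Finset.disjoint_left.1 (hUd _ _ hne) (hp i) (e ▸ hp i1)

lemma count_le {α : Type*} [Fintype α] (G : SimpleGraph α) (k : ℕ) (hk : 0 < k)
    (L : Finset (List α)) (x z : α) (hzx : G.Adj z x)
    (hL : ∀ l ∈ L, l.Nodup ∧ l.IsChain G.Adj ∧ l.head? = some x ∧ l.getLast? = some z ∧ l.length = k) :
    #L ≤ Nat.card {f : Fin k → α // IsCycleSeq G k f} := by
  classical
  have hc : #L = Nat.card L := by simp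
  rw [hc]
  have hcyc : ∀ l : L, IsCycleSeq G k (fun i => l.1[i.val]'(by
      rw [(hL l.1 l.2).2.2.2.2]; exact i.2)) := by
    rintro ⟨l, hl⟩
    obtain ⟨h1, h2, h3, h4, h5⟩ := hL l hl
    refine ⟨?_, ?_⟩
    · intro i j hij
      ext
      exact (h1.getElem_inj_iff).1 hij
    · intro i
      simp only
      rw [List.isChain_iff_getElem] at h2
      by_cases hi : i.val + 1 < k
      · have := h2 i.val (by omega)
        simpa [Nat.mod_eq_of_lt hi] using this
      · have hik : i.val = k - 1 := by omega
        have e1 : l[i.val]'(by omega) = z := by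
          rw [List.getLast?_eq_getElem?] at h4
          have h6 : i.val = l.length - 1 := by omega
          rw [← h6] at h4
          exact (List.getElem_eq_iff _).2 h4
        have e2 : (i.val + 1) % k = 0 := by
          have : i.val + 1 = k := by omega
          rw [this]; simp
        have e3 : l[(i.val + 1) % k]'(by rw [e2]; omega) = x := by
          rw [List.head?_eq_getElem?] at h3
          refine (List.getElem_eq_iff _).2 ?_
          rw [e2]; exact h3
        rw [e1, e3]; exact hzx
  refine Nat.card_le_card_of_injective (fun l : L => ⟨_, hcyc l⟩) ?_
  rintro ⟨l, hl⟩ ⟨l', hl'⟩ heq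
  simp only [Subtype.mk.injEq] at heq ⊢
  refine List.ext_getElem ?_ ?_
  · rw [(hL l hl).2.2.2.2, (hL l' hl').2.2.2.2]
  · intro i h1 h2
    have := (hL l hl).2.2.2.2
    exact congrFun heq ⟨i, by omega⟩

lemma eCnt_eq_sum {α : Type*} [Fintype α] [DecidableEq α] (G : SimpleGraph α) [DecidableRel G.Adj]
    (X Y : Finset α) : eCnt G X Y = ∑ x ∈ X, #{y ∈ Y | G.Adj x y} := by
  have h : eCnt G X Y = #{p ∈ X ×ˢ Y | G.Adj p.1 p.2} := by
    rw [eCnt, Nat.card_eq_fintype_card, Fintype.card_subtype]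
    congr 1
    ext p
    simp [and_assoc]
  rw [h, Finset.card_filter, Finset.sum_product]
  simp only [Finset.card_filter]

lemma eCnt_comm {α : Type*} (G : SimpleGraph α) (X Y : Finset α) : eCnt G X Y = eCnt G Y X := by
  rw [eCnt, eCnt]
  refine Nat.card_congr ((Equiv.prodComm α α).subtypeEquiv ?_)
  rintro ⟨x, y⟩
  simp [G.adj_comm]
  tauto

lemma dens_comm {α : Type*} (G : SimpleGraph α) (X Y : Finset α) : dens G X Y = dens G Y X := by
  rw [_root_.dens, _root_.dens, eCnt_comm, mul_comm]

lemma reg_comm {α : Type*} (G : SimpleGraph α) (X Y : Finset α) (ε : ℝ) (h : IsRegularPair G X Y ε) :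
    IsRegularPair G Y X ε := by
  intro U hU W hW h1 h2
  rw [dens_comm G U W, dens_comm G Y X]
  exact h W hW U hU h2 h1

open Classical in
lemma p1_half {α : Type*} [Fintype α] (G : SimpleGraph α) (U V : Finset α)
    (ε s : ℝ) (hs : 0 < s) (hs1 : s ≤ 1 / 10 ^ 10) (hε : ε = s * s)
    (hr : IsRegularPair G U V ε) (hd : 20 * s - ε ≤ dens G U V)
    (hU1 : 1 ≤ ε * #U) (hV1 : 1 ≤ ε * #V) (B : Finset α) (hB : B ⊆ V) (hBs : ⌈s * #V⌉₊ ≤ #B) :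
    #{u ∈ U | #{v ∈ B | G.Adj u v} < 3 * ⌈ε * #V⌉₊} < ⌈ε * #U⌉₊ := by
  by_contra! hcon
  set A := {u ∈ U | #{v ∈ B | G.Adj u v} < 3 * ⌈ε * #V⌉₊} with hA
  have hAc : ε * #U ≤ #A := Nat.ceil_le.1 hcon
  have hBc : s * #V ≤ #B := Nat.ceil_le.1 hBs
  have hV0 : (0:ℝ) ≤ #V := by positivity
  have hes : ε ≤ s := by rw [hε]; nlinarith
  have hBc' : ε * #V ≤ #B := le_trans (by nlinarith) hBc
  have h1 := hr A (Finset.filter_subset _ _) B hB hAc hBc'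
  have h2 : 19 * s ≤ dens G A B := by
    have := (abs_le.1 h1).1
    have : 2 * ε ≤ s := by rw [hε]; nlinarith
    linarith
  have hA0 : (0:ℝ) < #A := by linarith
  have hB0 : (0:ℝ) < #B := by linarith
  rw [_root_.dens, le_div_iff₀ (by positivity)] at h2
  have h3 : (eCnt G A B : ℝ) ≤ #A * (6 * (ε * #V)) := by
    rw [eCnt_eq_sum]
    push_cast
    have : ∀ a ∈ A, ((#{v ∈ B | G.Adj a v} : ℕ) : ℝ) ≤ 6 * (ε * #V) := by
      intro a ha
      have h4 := (Finset.mem_filter.1 ha).2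
      have h5 : ((#{v ∈ B | G.Adj a v} : ℕ) : ℝ) ≤ 3 * (⌈ε * #V⌉₊ : ℝ) := by exact_mod_cast h4.le
      have h6 := Nat.ceil_lt_add_one (show 0 ≤ ε * #V by linarith)
      linarith
    calc _ ≤ ∑ a ∈ A, 6 * (ε * #V) := Finset.sum_le_sum this
      _ = _ := by rw [Finset.sum_const, nsmul_eq_mul]
  have h7 : (#A : ℝ) * (19 * (ε * #V)) ≤ 19 * s * (#A * #B) := by
    have : ε * #V ≤ s * #B := by rw [hε]; nlinarith
    nlinarith
  nlinarith

lemma gp_of_regular {α : Type*} [Fintype α] (G : SimpleGraph α) (U V : Finset α)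
    (ε s : ℝ) (hs : 0 < s) (hs1 : s ≤ 1 / 10 ^ 10) (hε : ε = s * s) (hUV : Disjoint U V)
    (hr : IsRegularPair G U V ε) (hd : 20 * s - ε ≤ dens G U V)
    (hU1 : 1 ≤ ε * #U) (hV1 : 1 ≤ ε * #V) :
    GP G U V ⌈ε * #U⌉₊ ⌈ε * #V⌉₊ ⌈s * #U⌉₊ ⌈s * #V⌉₊ := by
  classical
  have hsz : ∀ X : Finset α, 1 ≤ ε * #X → ⌈s * #X⌉₊ + 2 * ⌈ε * #X⌉₊ ≤ #X := by
    intro X hX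
    have h0 : (0:ℝ) ≤ #X := by positivity
    have h1 := Nat.ceil_lt_add_one (show 0 ≤ ε * #X by linarith)
    have h2 := Nat.ceil_lt_add_one (show 0 ≤ s * #X by positivity)
    have h3 : ε ≤ s := by rw [hε]; nlinarith
    have h4 : ε * #X ≤ s * #X := by nlinarith
    have h5 : 6 * (s * #X) ≤ #X := by nlinarith
    have : ((⌈s * #X⌉₊ + 2 * ⌈ε * #X⌉₊ : ℕ) : ℝ) ≤ #X := by push_cast; linarith
    exact_mod_cast this
  refine ⟨hUV, ?_, ?_, ?_, hsz U hU1, hsz V hV1⟩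
  · intro B hB hBs
    exact p1_half G U V ε s hs hs1 hε hr hd hU1 hV1 B hB hBs
  · intro B hB hBs
    exact p1_half G V U ε s hs hs1 hε (reg_comm _ _ _ _ hr) (by rwa [dens_comm]) hV1 hU1 B hB hBs
  · intro A hA B hB hAc hBc
    have hAc : ε * #U ≤ #A := Nat.ceil_le.1 hAc
    have hBc : ε * #V ≤ #B := Nat.ceil_le.1 hBc
    have h1 := hr A hA B hB hAc hBc
    have h2 : 0 < dens G A B := by
      have := (abs_le.1 h1).1
      have : 2 * ε ≤ s := by rw [hε]; nlinarith
      linarith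
    by_contra! hcon
    have : eCnt G A B = 0 := by
      rw [eCnt_eq_sum]
      refine Finset.sum_eq_zero (fun a ha => ?_)
      rw [Finset.card_eq_zero, Finset.filter_eq_empty_iff]
      exact fun b hb => hcon a ha b hb
    rw [_root_.dens, this] at h2
    simp at h2

lemma final_arith (α : ℝ) (n k K E a X : ℕ) (hα : 0 < α) (hα1 : α ≤ 1) (hkn : k ≤ n)
    (hnk : n ≤ 2 * k) (h1 : 1 ≤ α / 4 * k) (ha : α * n ≤ a) (hK : K ≤ k) (hE : k ≤ E + K)
    (hn : (4 * n ^ (K + 1) : ℝ) ≤ 2 ^ n) (hX : a ^ E ≤ X) :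
    (α / 4 * k) ^ k ≤ ((X / (2 * k) : ℕ) : ℝ) := by
  have hk0 : 0 < k := by
    rcases Nat.eq_zero_or_pos k with h | h
    · rw [h] at h1; norm_num at h1
    · exact h
  have hkr : (0:ℝ) < k := by exact_mod_cast hk0
  have hknr : (k:ℝ) ≤ n := by exact_mod_cast hkn
  have hb1 : 1 ≤ α * n := by nlinarith
  set b := α * n with hb
  have hq := Nat.lt_mul_div_succ X (show 0 < 2 * k by omega)
  have hq' : (X : ℝ) < 2 * k * (((X / (2 * k) : ℕ) : ℝ) + 1) := by exact_mod_cast hq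
  have hx1 : 1 ≤ (α / 4 * k) ^ k := one_le_pow₀ h1
  have hxb : (α / 4 * k) ^ k ≤ (b / 4) ^ k := by
    apply pow_le_pow_left₀ (by positivity)
    rw [hb]; nlinarith
  have hXb : b ^ (k - K) ≤ X := by
    calc b ^ (k - K) ≤ b ^ E := pow_le_pow_right₀ hb1 (by omega)
      _ ≤ (a:ℝ) ^ E := pow_le_pow_left₀ (by linarith) ha _
      _ ≤ X := by exact_mod_cast hX
  have hmain : 4 * n * (b / 4) ^ k ≤ b ^ (k - K) := by
    have e : b ^ k = b ^ (k - K) * b ^ K := by rw [← pow_add]; congr 1; omega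
    rw [div_pow, e]
    have h2 : 4 * (n:ℝ) * b ^ K ≤ 4 ^ k := by
      calc 4 * (n:ℝ) * b ^ K ≤ 4 * n * (n:ℝ) ^ K := by
            gcongr
            rw [hb]; nlinarith
        _ = 4 * (n:ℝ) ^ (K + 1) := by ring
        _ ≤ 2 ^ n := hn
        _ ≤ 2 ^ (2 * k) := pow_le_pow_right₀ (by norm_num) hnk
        _ = 4 ^ k := by rw [pow_mul]; norm_num
    have h3 : 0 ≤ b ^ (k - K) := by positivity
    rw [← mul_div_assoc, div_le_iff₀ (by positivity)]
    nlinarith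
  have hfin : 2 * k * ((α / 4 * k) ^ k + 1) ≤ (X:ℝ) := by
    calc 2 * k * ((α / 4 * k) ^ k + 1) ≤ 2 * k * (2 * (b / 4) ^ k) := by
          gcongr; linarith
      _ = 4 * k * (b / 4) ^ k := by ring
      _ ≤ 4 * n * (b / 4) ^ k := by gcongr
      _ ≤ _ := hmain.trans hXb
  have := lt_of_le_of_lt hfin hq'
  have := lt_of_mul_lt_mul_left this (by positivity)
  linarith

lemma distribute (L m : ℕ) (hm : 0 < m) :
    ∃ t : ℕ → ℕ, ∑ i ∈ range m, t i = L ∧ ∀ i, t i ≤ L / m + 1 := by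
  refine ⟨fun i => L / m + if i < L % m then 1 else 0, ?_, ?_⟩
  · rw [Finset.sum_add_distrib, Finset.sum_const, Finset.card_range, Finset.sum_boole]
    have : {x ∈ range m | x < L % m} = range (L % m) := by
      ext x
      have := Nat.mod_lt L hm
      simp; omega
    rw [this]
    simp
    exact Nat.div_add_mod L m
  · intro i
    simp only
    split_ifs <;> omega


lemma cap_arith (s ε M c0 n m t' X : ℝ) (hs0 : 0 < s) (hs1 : s ≤ 1 / 10 ^ 10) (hεs : ε = s * s)
    (hM0 : 0 < M) (hc0M : c0 * M = 1 - ε) (hm : (2 / 3 + 13 * s) * M / 2 ≤ m) (ht0 : 0 ≤ t')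
    (hn0 : 0 ≤ n) (h4' : 3 * (m * t') ≤ n + 2) (E2 : 2 + 4 * M ≤ s * n) (hX : c0 * n ≤ X) :
    t' + 4 ≤ (1 - s - 2 * ε) * X := by
  have hεsmall : ε ≤ s / 10 := by rw [hεs]; nlinarith
  have hε0 : 0 < ε := by rw [hεs]; positivity
  have h5 : (1 + 39 / 2 * s) * (M * t') ≤ n + 2 := by
    have := mul_le_mul_of_nonneg_right hm ht0
    nlinarith
  have h6 : M * t' ≤ (1 - 10 * s) * (n + 2) := by
    have h7 : 1 ≤ (1 - 10 * s) * (1 + 39 / 2 * s) := by nlinarith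
    have h8 : 0 ≤ 1 - 10 * s := by linarith
    have h9 := mul_le_mul_of_nonneg_left h5 h8
    have h10 : 0 ≤ M * t' := by positivity
    nlinarith
  have h7 : M * (t' + 4) ≤ (1 - 3 * s) * n := by nlinarith
  have h8 : (1 - 3 * s) * n ≤ M * ((1 - s - 2 * ε) * X) := by
    have h9 : (1 - ε) * n ≤ M * X := by
      have := mul_le_mul_of_nonneg_left hX hM0.le
      calc (1 - ε) * n = M * (c0 * n) := by rw [← hc0M]; ring
        _ ≤ _ := this
    have h10 : 0 ≤ 1 - s - 2 * ε := by linarith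
    have h11 := mul_le_mul_of_nonneg_left h9 h10
    have h12 : 1 - 3 * s ≤ (1 - s - 2 * ε) * (1 - ε) := by nlinarith
    have h13 := mul_le_mul_of_nonneg_right h12 hn0
    linarith
  exact le_of_mul_le_mul_left (h7.trans h8) hM0

/-- many cycles `C_k`, `k = ⌈2(n+1)/3⌉` even, in Case 1 of the stability
lemma, with `d = 20√ε` and `λ = 13√ε`. (Here `⌈2(n+1)/3⌉ = (2(n+1)+2)/3` with natural
division.) -/
theorem cycles_in_case_one (ε : ℝ) (hε0 : 0 < ε) (hε1 : ε ≤ 1 / 10 ^ 20)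
    (M : ℕ) (hM : 0 < M) (c : ℝ) (hc : (1 - ε) / M ≤ c) :
    ∃ c' : ℝ, 0 < c' ∧ ∃ n₀ : ℕ, ∀ n : ℕ, n₀ ≤ n →
      Even ((2 * (n + 1) + 2) / 3) →
      ∀ G : SimpleGraph (Fin n), ∀ m : ℕ,
        (2 / 3 + 13 * Real.sqrt ε) * M / 2 ≤ (m : ℝ) →
        ∀ Us Vs : Fin m → Finset (Fin n),
          (∀ i j, i ≠ j → Disjoint (Us i) (Us j)) →
          (∀ i j, i ≠ j → Disjoint (Vs i) (Vs j)) →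
          (∀ i j, Disjoint (Us i) (Vs j)) →
          (∀ i, c * n ≤ ((Us i).card : ℝ) ∧ c * n ≤ ((Vs i).card : ℝ)) →
          (∀ i, IsRegularPair G (Us i) (Vs i) ε ∧
            20 * Real.sqrt ε - ε ≤ dens G (Us i) (Vs i)) →
          WellConnected G
            ((⋃ i, ((Us i : Set (Fin n)))) ∪ ⋃ i, ((Vs i : Set (Fin n)))) (200 * M) 6 →
          (c' * (((2 * (n + 1) + 2) / 3 : ℕ) : ℝ)) ^ ((2 * (n + 1) + 2) / 3 : ℕ)
            ≤ (cycleCount G ((2 * (n + 1) + 2) / 3) : ℝ) := by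
  set s := Real.sqrt ε with hs
  have hs0 : 0 < s := Real.sqrt_pos.2 hε0
  have hεs : ε = s * s := (Real.mul_self_sqrt hε0.le).symm
  have hs1 : s ≤ 1 / 10 ^ 10 := by
    rw [hs, Real.sqrt_le_left (by norm_num)]
    refine hε1.trans ?_
    norm_num
  have hεsmall : ε ≤ s / 10 := by rw [hεs]; nlinarith
  have hM' : (1:ℝ) ≤ M := by exact_mod_cast hM
  have hM0 : (0:ℝ) < M := by linarith
  set c0 := (1 - ε) / M with hc0
  have hc0M : c0 * M = 1 - ε := by rw [hc0]; field_simp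
  have hε2 : ε ≤ 1 / 100 := by linarith
  have hc0p : 0 < c0 := by rw [hc0]; apply div_pos <;> linarith
  have hc01 : c0 ≤ 1 := by nlinarith
  set α := ε * c0 / 2 with hα
  have hα0 : 0 < α := by positivity
  have hα1 : α ≤ 1 := by rw [hα]; nlinarith
  refine ⟨α / 4, by positivity, ?_⟩
  set K := 44 * M + 12 with hK
  have E1 : ∀ᶠ n : ℕ in Filter.atTop, (100 * M + 100 : ℝ) ≤ ε * c0 * n :=
    (tendsto_natCast_atTop_atTop.const_mul_atTop (by positivity)).eventually_ge_atTop _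
  have E2 : ∀ᶠ n : ℕ in Filter.atTop, (2 + 4 * M : ℝ) ≤ s * n :=
    (tendsto_natCast_atTop_atTop.const_mul_atTop hs0).eventually_ge_atTop _
  have E3 : ∀ᶠ n : ℕ in Filter.atTop, (4 * n ^ (K + 1) : ℝ) ≤ 2 ^ n := by
    have h := tendsto_pow_const_div_const_pow_of_one_lt (K + 1) (show (1:ℝ) < 2 by norm_num)
    have h2 := h.eventually (gt_mem_nhds (show (0:ℝ) < 1 / 4 by norm_num))
    filter_upwards [h2] with n hn
    rw [div_lt_iff₀ (by positivity)] at hn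
    linarith
  obtain ⟨n₀, hn₀⟩ := Filter.eventually_atTop.1 (E1.and (E2.and E3))
  refine ⟨n₀, ?_⟩
  intro n hn hev G m hm Us Vs hUd hVd hUVd hcard hreg hW
  obtain ⟨E1, E2, E3⟩ := hn₀ n hn
  set k := (2 * (n + 1) + 2) / 3 with hk
  have hn0 : (0:ℝ) ≤ n := by positivity
  have hnbig : 100 * M + 100 ≤ n := by
    have : (100 * M + 100 : ℝ) ≤ n := E1.trans (by nlinarith [mul_le_mul hε2 hc01 hc0p.le (by norm_num)])
    exact_mod_cast this
  have hcU : ∀ i, c0 * n ≤ (#(Us i) : ℝ) := fun i =>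
    (mul_le_mul_of_nonneg_right hc hn0).trans (hcard i).1
  have hcV : ∀ i, c0 * n ≤ (#(Vs i) : ℝ) := fun i =>
    (mul_le_mul_of_nonneg_right hc hn0).trans (hcard i).2
  have hm0 : 0 < m := by
    have : (0:ℝ) < m := lt_of_lt_of_le (by positivity) hm
    exact_mod_cast this
  have hm2 : m ≤ 2 * M := by
    have h1 : ∑ i, #(Us i) ≤ n := by
      rw [← Finset.card_biUnion (fun i _ j _ h => hUd i j h)]
      exact (Finset.card_le_univ _).trans (by simp)
    have h2 : (m:ℝ) * (c0 * n) ≤ n := by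
      calc (m:ℝ) * (c0 * n) = ∑ i : Fin m, c0 * n := by simp
        _ ≤ ∑ i, (#(Us i) : ℝ) := Finset.sum_le_sum (fun i _ => hcU i)
        _ ≤ n := by exact_mod_cast h1
    have hnp : (0:ℝ) < n := by
      have : 0 < n := by omega
      exact_mod_cast this
    have h3 : (m:ℝ) * c0 ≤ 1 := by
      by_contra! h; nlinarith
    have h4 : (m:ℝ) * (1 - ε) ≤ M := by rw [← hc0M]; nlinarith
    have : (m:ℝ) ≤ 2 * M := by nlinarith [show (0:ℝ) ≤ m by positivity]
    exact_mod_cast this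
  have hbig : ∀ X : Finset (Fin n), c0 * n ≤ (#X : ℝ) → (100 * M + 100 : ℝ) ≤ ε * #X := by
    intro X hX
    refine E1.trans ?_
    rw [mul_assoc]
    exact mul_le_mul_of_nonneg_left hX hε0.le
  have hGP : ∀ i, GP G (Us i) (Vs i) ⌈ε * #(Us i)⌉₊ ⌈ε * #(Vs i)⌉₊ ⌈s * #(Us i)⌉₊ ⌈s * #(Vs i)⌉₊ := by
    intro i
    refine gp_of_regular G (Us i) (Vs i) ε s hs0 hs1 hεs (hUVd i i) (hreg i).1 (hreg i).2 ?_ ?_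
    · have := hbig _ (hcU i); linarith
    · have := hbig _ (hcV i); linarith
  have hbig' : ∀ X : Finset (Fin n), c0 * n ≤ (#X : ℝ) → 100 * M + 100 ≤ ⌈ε * #X⌉₊ := by
    intro X hX
    have : ((100 * M + 100 : ℕ) : ℝ) ≤ (⌈ε * #X⌉₊ : ℝ) := by
      push_cast
      exact (hbig X hX).trans (Nat.le_ceil _)
    exact_mod_cast this
  obtain ⟨x, z, T, nd, ch, hzx, Tev, Tlen, hpq⟩ := skeleton_cycle G _ (200 * M) m hW hm0 Us Vs
    _ _ _ _ hGP hUd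
    (fun i y hy => Or.inl (Set.mem_iUnion.2 ⟨i, hy⟩))
    (fun i => by
      have := hbig' _ (hcU i)
      have := hbig' _ (hcV i)
      constructor <;> omega) (by omega)
  choose p q hp hq hpg hqg hinf using hpq
  have hkev : k % 2 = 0 := Nat.even_iff.1 hev
  have hTev : T.length % 2 = 0 := Nat.even_iff.1 Tev
  have hClen : (x :: T ++ [z]).length = T.length + 2 := by simp
  set L := (k - (T.length + 2)) / 2 - m with hL
  obtain ⟨t, ht1, ht2⟩ := distribute L m hm0
  set a := ⌊ε * c0 * n⌋₊ with ha
  have hale : ∀ X : Finset (Fin n), c0 * n ≤ (#X : ℝ) → a ≤ ⌈ε * #X⌉₊ := by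
    intro X hX
    refine (Nat.floor_le_ceil _).trans (Nat.ceil_mono ?_)
    rw [mul_assoc]
    exact mul_le_mul_of_nonneg_left hX hε0.le
  have hcap : ∀ X : Finset (Fin n), c0 * n ≤ (#X : ℝ) → ∀ i,
      t i + ⌈s * #X⌉₊ + 2 * ⌈ε * #X⌉₊ ≤ #X := by
    intro X hX i
    have hX0 : (0:ℝ) ≤ #X := Nat.cast_nonneg _
    have h1 := Nat.ceil_lt_add_one (mul_nonneg hε0.le hX0)
    have h2 := Nat.ceil_lt_add_one (mul_nonneg hs0.le hX0)
    have h3 : (t i : ℝ) ≤ (L / m : ℕ) + 1 := by exact_mod_cast ht2 i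
    have h4 : 3 * (m * (L / m)) ≤ n + 2 := by
      have := Nat.mul_div_le L m
      omega
    have h4' : 3 * ((m:ℝ) * ((L / m : ℕ) : ℝ)) ≤ n + 2 := by exact_mod_cast h4
    have h9 := cap_arith s ε M c0 n m _ _ hs0 hs1 hεs hM0 hc0M hm (Nat.cast_nonneg _) hn0 h4' E2 hX
    have : ((t i + ⌈s * #X⌉₊ + 2 * ⌈ε * #X⌉₊ : ℕ) : ℝ) ≤ #X := by push_cast; linarith
    exact_mod_cast this
  obtain ⟨N, hN1, hN2⟩ := replace_all G m Us Vs _ _ _ _ hGP hUd hVd hUVd a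
    (fun i => ⟨hale _ (hcU i), hale _ (hcV i)⟩) (x :: T ++ [z]) x z nd ch (by simp)
    (by rw [List.getLast?_append]; simp)
    (fun i => by
      have := hbig' _ (hcU i)
      have := hbig' _ (hcV i)
      rw [hClen]
      constructor <;> omega) p q hp hpg hqg hinf t
    (fun i => ⟨hcap _ (hcU i) i, hcap _ (hcV i) i⟩) m le_rfl
  rw [ht1] at hN1 hN2
  have hcount := count_le G k (by omega) N x z hzx (by
    intro l hl
    obtain ⟨r1, r2, r3, r4, r5, -, -⟩ := hN2 l hl
    refine ⟨r1, r2, r3, r4, ?_⟩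
    rw [r5, hClen]
    omega)
  rw [cycleCount]
  have h1 : (50:ℝ) ≤ α * n := by rw [hα]; linarith
  have hkr : (2 / 3 : ℝ) * n ≤ k := by
    have : 2 * n ≤ 3 * k := by omega
    have : (2:ℝ) * n ≤ 3 * k := by exact_mod_cast this
    linarith
  refine final_arith α n k K (2 * L) a _ hα0 hα1 (by omega) (by omega) ?_ ?_ (by omega) (by omega) E3
    (hN1.trans hcount)
  · nlinarith
  · have := Nat.lt_floor_add_one (ε * c0 * n)
    rw [← ha] at this
    rw [hα] at h1 ⊢
    linarith
end

section
/- For every 0 < ε ≤ 1/2 and 0 < d ≤ 1/2, there exist positive integers M_0 and n_0 such that for every two-coloring of the edges of K_n with n ≥ n_0 the following holds: there exist an integer M with 1000/ε ≤ M ≤ M_0, a vertex subset W with |W| ≥ n − 5600·M_0 which is (200M_0, 3)-well-connected in the red graph or in the blue graph, and a partition W = V_1 ∪ ⋯ ∪ V_M into parts whose sizes pairwise differ by at most one, such that for all but at most (ε/2)·(M choose 2) pairs 1 ≤ i < j ≤ M, the pair (V_i, V_j) is (ε/2)-regular in both the red and the blue graph (and hence has density at least d in at least one of the two colors). -/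
open Finset

/-- Goodness of a pair of vertices. -/
def GoodPair {V : Type*} (G : SimpleGraph V) (t : ℕ) (u v : V) : Prop :=
    ∃ P : Fin t → G.Walk u v, Function.Injective P ∧
      (∀ i, (P i).IsPath ∧ (P i).length ≤ 3) ∧
      (∀ i j, i ≠ j → ∀ x, x ∈ (P i).support → x ∈ (P j).support → x = u ∨ x = v)

lemma good_two {V : Type*} (G : SimpleGraph V) (t : ℕ) (u v : V) (huv : u ≠ v)
    (f : Fin t → V) (hf : Function.Injective f) (h1 : ∀ i, G.Adj u (f i))
    (h2 : ∀ i, G.Adj v (f i)) : GoodPair G t u v := by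
  have key : ∀ i j, i ≠ j → ∀ x,
      x ∈ (SimpleGraph.Walk.cons (h1 i) (SimpleGraph.Walk.cons (h2 i).symm .nil)).support →
      x ∈ (SimpleGraph.Walk.cons (h1 j) (SimpleGraph.Walk.cons (h2 j).symm .nil)).support →
      x = u ∨ x = v := by
    intro i j hij x hx hy
    have := hf.ne hij
    simp at hx hy
    grind
  refine ⟨fun i => .cons (h1 i) (.cons (h2 i).symm .nil), ?_, ?_, key⟩
  · intro i j hij
    by_contra hne
    have := key i j hne (f i) (by simp) (by
      have hh : (SimpleGraph.Walk.cons (h1 i) (SimpleGraph.Walk.cons (h2 i).symm .nil)) =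
        (SimpleGraph.Walk.cons (h1 j) (SimpleGraph.Walk.cons (h2 j).symm .nil)) := hij
      rw [← hh]; simp)
    rcases this with h | h
    · exact (h1 i).ne h.symm
    · exact (h2 i).ne h.symm
  · intro i
    have := (h1 i).ne
    have := (h2 i).ne
    constructor
    · simp [SimpleGraph.Walk.isPath_def]
      grind
    · simp

lemma good_three {V : Type*} (G : SimpleGraph V) (t : ℕ) (u v : V) (huv : u ≠ v)
    (f g : Fin t → V) (hf : Function.Injective f) (hg : Function.Injective g)
    (hfg : ∀ i j, f i ≠ g j) (hfv : ∀ i, f i ≠ v) (hgu : ∀ i, g i ≠ u)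
    (h1 : ∀ i, G.Adj u (f i)) (h2 : ∀ i, G.Adj (f i) (g i))
    (h3 : ∀ i, G.Adj (g i) v) : GoodPair G t u v := by
  have key : ∀ i j, i ≠ j → ∀ x,
      x ∈ (SimpleGraph.Walk.cons (h1 i) (.cons (h2 i) (.cons (h3 i) .nil))).support →
      x ∈ (SimpleGraph.Walk.cons (h1 j) (.cons (h2 j) (.cons (h3 j) .nil))).support →
      x = u ∨ x = v := by
    intro i j hij x hx hy
    have := hf.ne hij
    have := hg.ne hij
    have := hfg i j
    have := hfg j i
    simp at hx hy
    grind
  refine ⟨fun i => .cons (h1 i) (.cons (h2 i) (.cons (h3 i) .nil)), ?_, ?_, key⟩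
  · intro i j hij
    by_contra hne
    have := key i j hne (f i) (by simp) (by
      have hh : (SimpleGraph.Walk.cons (h1 i) (.cons (h2 i) (.cons (h3 i) .nil))) =
        (SimpleGraph.Walk.cons (h1 j) (.cons (h2 j) (.cons (h3 j) .nil))) := hij
      rw [← hh]; simp)
    rcases this with h | h
    · exact (h1 i).ne h.symm
    · exact hfv i h
  · intro i
    have := (h1 i).ne
    have := (h2 i).ne
    have := (h3 i).ne
    have := hfv i
    have := hgu i
    constructor
    · simp [SimpleGraph.Walk.isPath_def]
      grind
    · simp

/-- A set of pairs that forms a matching of bad pairs. -/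
def BadMatching {V : Type*} (G : SimpleGraph V) (t : ℕ) (M : Finset (V × V)) : Prop :=
  (∀ p ∈ M, p.1 ≠ p.2 ∧ ¬ GoodPair G t p.1 p.2) ∧
  ∀ p ∈ M, ∀ q ∈ M, p ≠ q → p.1 ≠ q.1 ∧ p.1 ≠ q.2 ∧ p.2 ≠ q.1 ∧ p.2 ≠ q.2

open Classical in
lemma BadMatching.touch {V : Type*} {G : SimpleGraph V} {t : ℕ} {M : Finset (V × V)}
    (hM : BadMatching G t M) (S : Finset V) :
    #{q ∈ M | q.1 ∈ S ∨ q.2 ∈ S} ≤ #S := by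
  apply Finset.card_le_card_of_injOn (fun q => if q.1 ∈ S then q.1 else q.2)
  · intro q hq
    simp at hq ⊢
    split_ifs <;> grind
  · intro p hp q hq hpq
    simp at hp hq hpq
    by_contra hne
    have := hM.2 p hp.1 q hq.1 hne
    split_ifs at hpq <;> grind

open Classical in
/-- endpoints and common neighbours -/
noncomputable def exc {V : Type*} [Fintype V] (G : SimpleGraph V) (p : V × V) : Finset V :=
  Finset.univ.filter (fun x => x = p.1 ∨ x = p.2 ∨ (G.Adj p.1 x ∧ G.Adj p.2 x))

open Classical in
lemma exc_card {V : Type*} [Fintype V] (G : SimpleGraph V) (t : ℕ) (p : V × V)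
    (hp : p.1 ≠ p.2) (hb : ¬ GoodPair G t p.1 p.2) : #(exc G p) ≤ t + 1 := by
  have h1 : #(Finset.univ.filter (fun x => G.Adj p.1 x ∧ G.Adj p.2 x)) < t := by
    by_contra! h
    obtain ⟨S, hS, hc⟩ := Finset.exists_subset_card_eq h
    let e := (S.equivFinOfCardEq hc).symm
    have he : ∀ i, G.Adj p.1 (e i) ∧ G.Adj p.2 (e i) := fun i => by
      simpa using hS (e i).2
    exact hb (good_two G t _ _ hp (fun i => (e i : V))
      (Subtype.val_injective.comp e.injective) (fun i => (he i).1) (fun i => (he i).2))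
  have h2 : exc G p ⊆ {p.1, p.2} ∪ Finset.univ.filter (fun x => G.Adj p.1 x ∧ G.Adj p.2 x) := by
    intro x hx
    simp [exc] at hx ⊢
    tauto
  have h3 := Finset.card_le_card h2
  have h4 := Finset.card_union_le ({p.1, p.2} : Finset V)
    (Finset.univ.filter (fun x => G.Adj p.1 x ∧ G.Adj p.2 x))
  have h5 : #({p.1, p.2} : Finset V) ≤ 2 := Finset.card_le_two
  omega

open Classical in
/-- exceptional relation -/
lemma exists_good_red {V : Type*} [Fintype V] (G : SimpleGraph V) (t m : ℕ) (hm : 0 < m)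
    (A B : Finset (V × V)) (hA : BadMatching G t A) (hB : BadMatching Gᶜ t B)
    (cA : #A = m) (cB : #B = m) :
    ∃ p ∈ A, ∃ Q ⊆ B, m ≤ #Q + 2 * (t + 1) ∧
      ∀ q ∈ Q, q.1 ∉ exc G p ∧ q.2 ∉ exc G p ∧ p.1 ∉ exc Gᶜ q ∧ p.2 ∉ exc Gᶜ q := by
  let E1 : V × V → V × V → Prop := fun p q => q.1 ∈ exc G p ∨ q.2 ∈ exc G p
  let E2 : V × V → V × V → Prop := fun p q => p.1 ∈ exc Gᶜ q ∨ p.2 ∈ exc Gᶜ q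
  have h1 : ∀ p ∈ A, #{q ∈ B | E1 p q} ≤ t + 1 := fun p hp =>
    (hB.touch (exc G p)).trans (exc_card G t p (hA.1 p hp).1 (hA.1 p hp).2)
  have h2 : ∀ q ∈ B, #{p ∈ A | E2 p q} ≤ t + 1 := fun q hq =>
    (hA.touch (exc Gᶜ q)).trans (exc_card Gᶜ t q (hB.1 q hq).1 (hB.1 q hq).2)
  have h3 : ∑ p ∈ A, #{q ∈ B | E2 p q} ≤ m * (t + 1) := by
    have := Finset.sum_card_bipartiteAbove_eq_sum_card_bipartiteBelow (s := A) (t := B) E2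
    simp only [Finset.bipartiteAbove, Finset.bipartiteBelow] at this
    rw [this, ← cB, ← smul_eq_mul]
    exact Finset.sum_le_card_nsmul _ _ _ h2
  obtain ⟨p, hp, hpE⟩ : ∃ p ∈ A, #{q ∈ B | E2 p q} ≤ t + 1 := by
    by_contra! h
    have : ∑ p ∈ A, (t + 1) < ∑ p ∈ A, #{q ∈ B | E2 p q} :=
      Finset.sum_lt_sum_of_nonempty (Finset.card_pos.1 (by omega)) h
    rw [Finset.sum_const, cA, smul_eq_mul] at this
    omega
  refine ⟨p, hp, {q ∈ B | ¬ (E1 p q ∨ E2 p q)}, Finset.filter_subset _ _, ?_, ?_⟩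
  · have a := Finset.card_filter_add_card_filter_not (s := B) (fun q => E1 p q ∨ E2 p q)
    have b : #{q ∈ B | E1 p q ∨ E2 p q} ≤ #{q ∈ B | E1 p q} + #{q ∈ B | E2 p q} := by
      rw [Finset.filter_or]; exact Finset.card_union_le _ _
    have := h1 p hp
    omega
  · intro q hq
    simp [E1, E2] at hq
    tauto

open Classical in
lemma no_both {V : Type*} [Fintype V] (G : SimpleGraph V) (t m : ℕ) (ht : 0 < t)
    (hm : 14 * t ≤ m)
    (A B : Finset (V × V)) (hA : BadMatching G t A) (hB : BadMatching Gᶜ t B)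
    (cA : #A = m) (cB : #B = m) : False := by
  obtain ⟨p, hp, Q, hQB, hQc, hQ⟩ := exists_good_red G t m (by omega) A B hA hB cA cB
  obtain ⟨hp12, hpb⟩ := hA.1 p hp
  let x : V × V → V := fun q => if G.Adj p.1 q.1 then q.1 else q.2
  let y : V × V → V := fun q => if G.Adj p.1 q.1 then q.2 else q.1
  have hx : ∀ q ∈ Q, G.Adj p.1 (x q) ∧ G.Adj p.2 (y q) ∧ x q ≠ p.2 ∧ y q ≠ p.1 := by
    intro q hq
    have h := hQ q hq
    simp only [exc, Finset.mem_filter, Finset.mem_univ, true_and, SimpleGraph.compl_adj] at h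
    have := G.adj_comm
    have := (hB.1 q (hQB hq)).1
    simp only [x, y]
    split_ifs <;> grind
  have hxy : ∀ q ∈ Q, ∀ q' ∈ Q, x q ≠ y q' := by
    intro q hq q' hq'
    by_cases e : q = q'
    · subst e
      have := (hB.1 q (hQB hq)).1
      simp only [x, y]
      split_ifs <;> grind
    · have := hB.2 q (hQB hq) q' (hQB hq') e
      simp only [x, y]
      split_ifs <;> grind
  have hxi : ∀ q ∈ Q, ∀ q' ∈ Q, x q = x q' → q = q' := by
    intro q hq q' hq' h
    by_contra e
    have := hB.2 q (hQB hq) q' (hQB hq') e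
    simp only [x] at h
    split_ifs at h <;> grind
  have hyi : ∀ q ∈ Q, ∀ q' ∈ Q, y q = y q' → q = q' := by
    intro q hq q' hq' h
    by_contra e
    have := hB.2 q (hQB hq) q' (hQB hq') e
    simp only [y] at h
    split_ifs at h <;> grind
  let PM : Finset ((V × V) × (V × V)) → Prop := fun N =>
    N ⊆ Q ×ˢ Q ∧ (∀ r ∈ N, G.Adj (x r.1) (y r.2)) ∧
      ∀ r ∈ N, ∀ s ∈ N, r ≠ s → r.1 ≠ s.1 ∧ r.2 ≠ s.2
  obtain ⟨N, hN, hNmax⟩ := Finset.exists_max_image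
    (Finset.univ.filter PM) Finset.card ⟨∅, by simp [PM]⟩
  simp only [Finset.mem_filter, Finset.mem_univ, true_and] at hN hNmax
  have hNt : #N < t := by
    by_contra! h
    obtain ⟨S, hS, hc⟩ := Finset.exists_subset_card_eq h
    let e := (S.equivFinOfCardEq hc).symm
    have heN : ∀ i, (e i : (V × V) × (V × V)) ∈ N := fun i => hS (e i).2
    have heQ : ∀ i, (e i : (V × V) × (V × V)).1 ∈ Q ∧ (e i : (V × V) × (V × V)).2 ∈ Q :=
      fun i => Finset.mem_product.1 (hN.1 (heN i))
    have hei : ∀ i j, i ≠ j → (e i : (V × V) × (V × V)) ≠ e j := fun i j hij h =>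
      hij (e.injective (Subtype.ext h))
    refine hpb (good_three G t _ _ hp12 (fun i => x (e i).1.1) (fun i => y (e i).1.2)
      ?_ ?_ ?_ ?_ ?_ ?_ ?_ ?_)
    · intro i j hij
      by_contra hne
      exact (hN.2.2 _ (heN i) _ (heN j) (hei i j hne)).1 (hxi _ (heQ i).1 _ (heQ j).1 hij)
    · intro i j hij
      by_contra hne
      exact (hN.2.2 _ (heN i) _ (heN j) (hei i j hne)).2 (hyi _ (heQ i).2 _ (heQ j).2 hij)
    · exact fun i j => hxy _ (heQ i).1 _ (heQ j).2
    · exact fun i => (hx _ (heQ i).1).2.2.1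
    · exact fun i => (hx _ (heQ i).2).2.2.2
    · exact fun i => (hx _ (heQ i).1).1
    · exact fun i => hN.2.1 _ (heN i)
    · exact fun i => (hx _ (heQ i).2).2.1.symm
  let Q' := Q \ (N.image Prod.fst ∪ N.image Prod.snd)
  have hQ'c : t + 1 ≤ #Q' := by
    have a := Finset.le_card_sdiff (N.image Prod.fst ∪ N.image Prod.snd) Q
    have b := Finset.card_union_le (N.image Prod.fst) (N.image Prod.snd)
    have c := Finset.card_image_le (s := N) (f := Prod.fst)
    have d := Finset.card_image_le (s := N) (f := Prod.snd)
    change t + 1 ≤ #(Q \ (N.image Prod.fst ∪ N.image Prod.snd))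
    omega
  have hQ'Q : Q' ⊆ Q := Finset.sdiff_subset
  have hblue : ∀ q ∈ Q', ∀ q' ∈ Q', Gᶜ.Adj (x q) (y q') := by
    intro q hq q' hq'
    rw [SimpleGraph.compl_adj]
    refine ⟨hxy q (hQ'Q hq) q' (hQ'Q hq'), fun hadj => ?_⟩
    simp only [Q', Finset.mem_sdiff, Finset.mem_union, Finset.mem_image, not_or, not_exists,
      not_and] at hq hq'
    have hnot : (q, q') ∉ N := fun h => hq.2.1 _ h rfl
    have := hNmax (insert (q, q') N) (by
      refine ⟨?_, ?_, ?_⟩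
      · intro r hr
        rcases Finset.mem_insert.1 hr with rfl | hr
        · exact Finset.mem_product.2 ⟨hq.1, hq'.1⟩
        · exact hN.1 hr
      · intro r hr
        rcases Finset.mem_insert.1 hr with rfl | hr
        · exact hadj
        · exact hN.2.1 r hr
      · intro r hr s hs hrs
        rcases Finset.mem_insert.1 hr with rfl | hr <;> rcases Finset.mem_insert.1 hs with rfl | hs
        · exact absurd rfl hrs
        · exact ⟨fun h => hq.2.1 s hs h.symm, fun h => hq'.2.2 s hs h.symm⟩
        · exact ⟨fun h => hq.2.1 r hr h, fun h => hq'.2.2 r hr h⟩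
        · exact hN.2.2 r hr s hs hrs)
    rw [Finset.card_insert_of_notMem hnot] at this
    omega
  obtain ⟨q0, hq0⟩ : Q'.Nonempty := Finset.card_pos.1 (by omega)
  have hc : t ≤ #(Q'.erase q0) := by rw [Finset.card_erase_of_mem hq0]; omega
  obtain ⟨S, hS, hc⟩ := Finset.exists_subset_card_eq hc
  let e := (S.equivFinOfCardEq hc).symm
  have he : ∀ i, (e i : V × V) ≠ q0 ∧ (e i : V × V) ∈ Q' := fun i =>
    Finset.mem_erase.1 (hS (e i).2)
  have hei : Function.Injective (fun i => (e i : V × V)) :=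
    Subtype.val_injective.comp e.injective
  have hex : Function.Injective (fun i => x (e i)) := fun i j h =>
    hei (hxi _ (hQ'Q (he i).2) _ (hQ'Q (he j).2) h)
  have hey : Function.Injective (fun i => y (e i)) := fun i j h =>
    hei (hyi _ (hQ'Q (he i).2) _ (hQ'Q (he j).2) h)
  have hq0Q := hQ'Q hq0
  have g1 : GoodPair Gᶜ t (x q0) (y q0) :=
    good_three Gᶜ t _ _ (hxy _ hq0Q _ hq0Q) (fun i => y (e i)) (fun i => x (e i)) hey hex
      (fun i j => (hxy _ (hQ'Q (he j).2) _ (hQ'Q (he i).2)).symm)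
      (fun i h => (he i).1 (hyi _ (hQ'Q (he i).2) _ hq0Q h))
      (fun i h => (he i).1 (hxi _ (hQ'Q (he i).2) _ hq0Q h))
      (fun i => hblue _ hq0 _ (he i).2) (fun i => (hblue _ (he i).2 _ (he i).2).symm)
      (fun i => hblue _ (he i).2 _ hq0)
  have g2 : GoodPair Gᶜ t (y q0) (x q0) :=
    good_three Gᶜ t _ _ (hxy _ hq0Q _ hq0Q).symm (fun i => x (e i)) (fun i => y (e i)) hex hey
      (fun i j => (hxy _ (hQ'Q (he i).2) _ (hQ'Q (he j).2)))
      (fun i h => (he i).1 (hxi _ (hQ'Q (he i).2) _ hq0Q h))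
      (fun i h => (he i).1 (hyi _ (hQ'Q (he i).2) _ hq0Q h))
      (fun i => (hblue _ (he i).2 _ hq0).symm) (fun i => (hblue _ (he i).2 _ (he i).2))
      (fun i => (hblue _ hq0 _ (he i).2).symm)
  have hbad := (hB.1 q0 (hQB hq0Q)).2
  by_cases h : G.Adj p.1 q0.1
  · simp only [x, y, h, if_true] at g1
    exact hbad g1
  · simp only [x, y, h, if_false] at g2
    exact hbad g2

open Classical in
lemma cover_or {V : Type*} [Fintype V] (G : SimpleGraph V) (t : ℕ) :
    (∃ W : Finset V, Fintype.card V ≤ #W + 28 * t ∧ WellConnected G (↑W) t 3) ∨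
    ∃ A, BadMatching G t A ∧ #A = 14 * t := by
  obtain ⟨N, hN, hNmax⟩ := Finset.exists_max_image
    (Finset.univ.filter (BadMatching G t)) Finset.card ⟨∅, by simp [BadMatching]⟩
  simp only [Finset.mem_filter, Finset.mem_univ, true_and] at hN hNmax
  rcases le_total (#N) (14 * t) with h | h
  · left
    refine ⟨(N.image Prod.fst ∪ N.image Prod.snd)ᶜ, ?_, ?_⟩
    · have b := Finset.card_union_le (N.image Prod.fst) (N.image Prod.snd)
      have c := Finset.card_image_le (s := N) (f := Prod.fst)
      have d := Finset.card_image_le (s := N) (f := Prod.snd)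
      have e := Finset.card_compl_add_card (N.image Prod.fst ∪ N.image Prod.snd)
      omega
    · intro u hu v hv huv
      by_contra hbad
      simp only [Finset.mem_coe, Finset.mem_compl, Finset.mem_union, Finset.mem_image, not_or,
        not_exists, not_and] at hu hv
      have hnot : (u, v) ∉ N := fun h => hu.1 _ h rfl
      have := hNmax (insert (u, v) N) (by
        refine ⟨?_, ?_⟩
        · intro r hr
          rcases Finset.mem_insert.1 hr with rfl | hr
          · exact ⟨huv, hbad⟩
          · exact hN.1 r hr
        · intro r hr s hs hrs
          rcases Finset.mem_insert.1 hr with rfl | hr <;>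
            rcases Finset.mem_insert.1 hs with rfl | hs
          · exact absurd rfl hrs
          · exact ⟨fun h => hu.1 s hs h.symm, fun h => hu.2 s hs h.symm,
              fun h => hv.1 s hs h.symm, fun h => hv.2 s hs h.symm⟩
          · exact ⟨fun h => hu.1 r hr h, fun h => hv.1 r hr h,
              fun h => hu.2 r hr h, fun h => hv.2 r hr h⟩
          · exact hN.2 r hr s hs hrs)
      rw [Finset.card_insert_of_notMem hnot] at this
      omega
  · right
    obtain ⟨S, hS, hc⟩ := Finset.exists_subset_card_eq h
    exact ⟨S, ⟨fun p hp => hN.1 p (hS hp), fun p hp q hq => hN.2 p (hS hp) q (hS hq)⟩, hc⟩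

lemma exists_wellConnected {V : Type*} [Fintype V] (G : SimpleGraph V) (t : ℕ) (ht : 0 < t) :
    ∃ W : Finset V, Fintype.card V ≤ #W + 28 * t ∧
      (WellConnected G (↑W) t 3 ∨ WellConnected Gᶜ (↑W) t 3) := by
  rcases cover_or G t with ⟨W, h, h'⟩ | ⟨A, hA, cA⟩
  · exact ⟨W, h, Or.inl h'⟩
  rcases cover_or Gᶜ t with ⟨W, h, h'⟩ | ⟨B, hB, cB⟩
  · exact ⟨W, h, Or.inr h'⟩
  exact (no_both G t (14 * t) ht le_rfl A B hA hB cA cB).elim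

open Classical in
lemma eCnt_eq {V : Type*} [Fintype V] (G : SimpleGraph V) [DecidableRel G.Adj] (X Y : Finset V) :
    eCnt G X Y = #(G.interedges X Y) := by
  unfold eCnt
  rw [Nat.card_eq_fintype_card, Fintype.card_subtype]
  congr 1
  ext p
  simp [SimpleGraph.interedges_def, and_assoc]

open Classical in
lemma dens_eq {V : Type*} [Fintype V] (G : SimpleGraph V) [DecidableRel G.Adj] (X Y : Finset V) :
    dens G X Y = (G.edgeDensity X Y : ℝ) := by
  rw [_root_.dens.eq_1, eCnt_eq, SimpleGraph.edgeDensity_def]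
  push_cast
  rfl

open Classical in
lemma dens_map {V U : Type*} [Fintype V] [Fintype U] (G : SimpleGraph V) (f : U ↪ V)
    [DecidableRel (G.comap f).Adj] (X Y : Finset U) :
    dens G (X.map f) (Y.map f) = ((G.comap f).edgeDensity X Y : ℝ) := by
  rw [← dens_eq, _root_.dens.eq_1, _root_.dens.eq_1, eCnt_eq, eCnt_eq, Finset.card_map, Finset.card_map]
  congr 2
  symm
  rw [← Finset.card_map (f.prodMap f)]
  congr 1
  ext ⟨a, b⟩
  simp only [SimpleGraph.interedges_def, Finset.mem_map, Finset.mem_filter, Finset.mem_product,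
    SimpleGraph.comap_adj, Function.Embedding.prodMap, Prod.exists, Function.Embedding.coeFn_mk,
    Prod.map, Prod.mk.injEq]
  constructor
  · rintro ⟨c, e, ⟨⟨h1, h2⟩, h3⟩, rfl, rfl⟩
    exact ⟨⟨⟨c, h1, rfl⟩, ⟨e, h2, rfl⟩⟩, h3⟩
  · rintro ⟨⟨⟨c, h1, rfl⟩, ⟨e, h2, rfl⟩⟩, h3⟩
    exact ⟨c, e, ⟨⟨h1, h2⟩, h3⟩, rfl, rfl⟩

open Classical in
lemma dens_compl {V : Type*} [Fintype V] (G : SimpleGraph V) (X Y : Finset V)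
    (hX : X.Nonempty) (hY : Y.Nonempty) (h : Disjoint X Y) :
    dens Gᶜ X Y = 1 - dens G X Y := by
  have := G.edgeDensity_add_edgeDensity_compl hX hY h
  rw [dens_eq, dens_eq, eq_sub_iff_add_eq, add_comm]
  have h2 : ((G.edgeDensity X Y + Gᶜ.edgeDensity X Y : ℚ) : ℝ) = 1 := by
    rw [← Rat.cast_one, Rat.cast_inj]
    convert this
  push_cast at h2
  exact h2

lemma regular_compl {V : Type*} [Fintype V] (G : SimpleGraph V) (X Y : Finset V) (ε : ℝ)
    (hε : 0 < ε) (hX : X.Nonempty) (hY : Y.Nonempty) (h : Disjoint X Y)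
    (hr : IsRegularPair G X Y ε) : IsRegularPair Gᶜ X Y ε := by
  intro U hU W hW h1 h2
  have a : (0 : ℝ) < #X := by exact_mod_cast hX.card_pos
  have b : (0 : ℝ) < #Y := by exact_mod_cast hY.card_pos
  have hU0 : U.Nonempty := Finset.card_pos.1 (by
    have : (0 : ℝ) < #U := lt_of_lt_of_le (by positivity) h1
    exact_mod_cast this)
  have hW0 : W.Nonempty := Finset.card_pos.1 (by
    have : (0 : ℝ) < #W := lt_of_lt_of_le (by positivity) h2
    exact_mod_cast this)
  rw [dens_compl G X Y hX hY h, dens_compl G U W hU0 hW0 (h.mono hU hW)]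
  have := hr U hU W hW h1 h2
  rw [abs_sub_comm] at this
  convert this using 2
  ring

open Classical in
lemma regular_map {V U : Type*} [Fintype V] [Fintype U] (G : SimpleGraph V) (f : U ↪ V)
    [DecidableRel (G.comap f).Adj] (X Y : Finset U) (ε ε' : ℝ) (hε : ε' ≤ ε) (h : (G.comap f).IsUniform ε' X Y) :
    IsRegularPair G (X.map f) (Y.map f) ε := by
  intro S hS T hT h1 h2
  obtain ⟨S, hS', rfl⟩ := Finset.subset_map_iff.1 hS
  obtain ⟨T, hT', rfl⟩ := Finset.subset_map_iff.1 hT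
  rw [Finset.card_map, Finset.card_map] at h1
  rw [Finset.card_map, Finset.card_map] at h2
  rw [dens_map, dens_map]
  refine ((h.mono hε) hS' hT' ?_ ?_).le
  · rwa [mul_comm]
  · rwa [mul_comm]

/-- the colored regularity lemma combined with a well-connected subset
(Lemma 3.5 of the paper). -/
theorem regularity_with_well_connected (ε d : ℝ) (hε0 : 0 < ε) (hε1 : ε ≤ 1 / 2)
    (hd0 : 0 < d) (hd1 : d ≤ 1 / 2) :
    ∃ M₀ n₀ : ℕ, 0 < M₀ ∧ 0 < n₀ ∧ ∀ n : ℕ, n₀ ≤ n → ∀ R : SimpleGraph (Fin n),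
      ∃ M : ℕ, (1000 / ε ≤ (M : ℝ)) ∧ M ≤ M₀ ∧
      ∃ W : Finset (Fin n), n - 5600 * M₀ ≤ W.card ∧
        (WellConnected R (↑W) (200 * M₀) 3 ∨ WellConnected Rᶜ (↑W) (200 * M₀) 3) ∧
        ∃ P : Fin M → Finset (Fin n),
          (∀ i j, i ≠ j → Disjoint (P i) (P j)) ∧
          Finset.univ.biUnion P = W ∧
          (∀ i j, (P i).card ≤ (P j).card + 1) ∧
          ∃ Bad : Finset (Fin M × Fin M),
            ((Bad.card : ℝ) ≤ ε / 2 * (M.choose 2)) ∧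
            ∀ i j : Fin M, i < j → (i, j) ∉ Bad →
              IsRegularPair R (P i) (P j) (ε / 2) ∧
              IsRegularPair Rᶜ (P i) (P j) (ε / 2) ∧
              (d ≤ dens R (P i) (P j) ∨ d ≤ dens Rᶜ (P i) (P j)) := by
  classical
  set l : ℕ := ⌈1000 / ε⌉₊ with hl
  set M₀ : ℕ := SzemerediRegularity.bound (ε / 4) l with hM₀
  have hM₀pos : 0 < M₀ := SzemerediRegularity.bound_pos _ _
  refine ⟨M₀, 5600 * M₀ + l + 1, hM₀pos, by omega, ?_⟩
  intro n hn R
  obtain ⟨W, hWc, hW⟩ := exists_wellConnected R (200 * M₀) (by omega)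
  rw [Fintype.card_fin] at hWc
  let f : W ↪ Fin n := Function.Embedding.subtype _
  have hlW : l ≤ Fintype.card W := by rw [Fintype.card_coe]; omega
  obtain ⟨Q, hQe, hQl, hQu, hQ⟩ :=
    szemeredi_regularity (R.comap f) (ε := ε / 4) (by positivity) hlW
  let e := Q.parts.equivFin.symm
  have hne : ∀ i, ((e i).1.map f).Nonempty := fun i =>
    (Q.nonempty_of_mem_parts (e i).2).map
  have hdis : ∀ i j, i ≠ j → Disjoint ((e i).1.map f) ((e j).1.map f) := by
    intro i j hij
    rw [Finset.disjoint_map]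
    exact Q.disjoint (e i).2 (e j).2 (fun h => hij (e.injective (Subtype.ext h)))
  refine ⟨#Q.parts, (Nat.le_ceil _).trans (by exact_mod_cast hQl), hQu, W, by omega, hW,
    fun i => (e i).1.map f, hdis, ?_, ?_, ?_⟩
  · ext x
    simp only [Finset.mem_biUnion, Finset.mem_univ, true_and, Finset.mem_map]
    constructor
    · rintro ⟨i, a, -, rfl⟩
      exact a.2
    · intro hx
      obtain ⟨s, hs, hxs⟩ := Q.exists_mem (Finset.mem_univ (⟨x, hx⟩ : W))
      exact ⟨e.symm ⟨s, hs⟩, ⟨x, hx⟩, by simpa using hxs, rfl⟩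
  · intro i j
    rw [Finset.card_map, Finset.card_map]
    exact hQe (e i).2 (e j).2
  · refine ⟨Finset.univ.filter (fun p => p.1 < p.2 ∧
      ¬ (R.comap f).IsUniform (ε / 4) (e p.1).1 (e p.2).1), ?_, ?_⟩
    · have h1 : #(Finset.univ.filter (fun p : Fin #Q.parts × Fin #Q.parts => p.1 < p.2 ∧
          ¬ (R.comap f).IsUniform (ε / 4) (e p.1).1 (e p.2).1)) ≤
          #(Q.nonUniforms (R.comap f) (ε / 4)) := by
        apply Finset.card_le_card_of_injOn (fun p => ((e p.1).1, (e p.2).1))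
        · intro p hp
          simp only [Finset.coe_filter, Finset.mem_univ, true_and, Set.mem_ofPred_eq] at hp
          rw [Finset.mem_coe, Finpartition.mk_mem_nonUniforms]
          exact ⟨(e p.1).2, (e p.2).2,
            fun h => hp.1.ne (e.injective (Subtype.ext h)), hp.2⟩
        · intro p _ q _ h
          simp only [Prod.mk.injEq] at h
          exact Prod.ext (e.injective (Subtype.ext h.1)) (e.injective (Subtype.ext h.2))
      have h2 : (#(Q.nonUniforms (R.comap f) (ε / 4)) : ℝ) ≤
        (#Q.parts * (#Q.parts - 1) : ℕ) * (ε / 4) := hQ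
      have h3 : #Q.parts * (#Q.parts - 1) = 2 * (#Q.parts).choose 2 := by
        rw [Nat.choose_two_right, Nat.mul_div_cancel' (Nat.even_mul_pred_self _).two_dvd]
      rw [h3] at h2
      push_cast at h2
      have h1' := (Nat.cast_le (α := ℝ)).2 h1
      linarith
    · intro i j hij hb
      simp only [Finset.mem_filter, Finset.mem_univ, true_and, not_and, not_not] at hb
      have hd := hdis i j hij.ne
      have hr := regular_map R f (e i).1 (e j).1 (ε / 2) (ε / 4) (by linarith) (hb hij)
      refine ⟨hr, regular_compl R _ _ _ (by positivity) (hne i) (hne j) hd hr, ?_⟩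
      rw [dens_compl R _ _ (hne i) (hne j) hd]
      by_contra! h
      linarith [h.1, h.2]
end
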